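/- arXiv:1609.01677 — 7 statements merged into one kernel-verified Lean document; each statement's English description precedes it below -/
import Mathlib

section
/- Every finite simple graph G on n ≥ 1 vertices satisfies f(G) ≥ (1/250)·√(n/hom(G)). -/
open Finset
open scoped Classical

/-- The number of distinct vertex degrees in the subgraph of `G` induced by `s`. -/
noncomputable def distinctDegrees {V : Type*} (G : SimpleGraph V) (s : Finset V) : ℕ :=
  (s.image fun x => (s.filter fun y => G.Adj x y).card).card

/-- `f(G)`: the largest number of distinct degrees in an induced subgraph of `G`. -/
noncomputable def fNumber {V : Type*} [Fintype V] (G : SimpleGraph V) : ℕ :=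
  sSup {m : ℕ | ∃ s : Finset V, distinctDegrees G s = m}

/-- `hom(G)`: the size of the largest clique or independent set of `G`. -/
noncomputable def homNumber {V : Type*} (G : SimpleGraph V) : ℕ :=
  sSup {n : ℕ | ∃ s : Finset V, (G.IsClique ↑s ∨ Gᶜ.IsClique ↑s) ∧ s.card = n}

/-- The neighbourhood-distance `δ(x,y) = |(Γ(x)\{y}) △ (Γ(y)\{x})|`. -/
noncomputable def nbhdDist {V : Type*} [Fintype V] (G : SimpleGraph V) (x y : V) : ℕ :=
  (symmDiff ((G.neighborFinset x).erase y) ((G.neighborFinset y).erase x)).card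

theorem two_mul_add_one_mul_centralBinom_sq_le (m : ℕ) :
    (2 * m + 1) * m.centralBinom ^ 2 ≤ 16 ^ m := by
  induction m with
  | zero => simp
  | succ m ih =>
    have hrec := Nat.succ_mul_centralBinom_succ m
    have hpos : 0 < (m + 1) ^ 2 := by positivity
    refine Nat.le_of_mul_le_mul_left ?_ hpos
    calc (m + 1) ^ 2 * ((2 * (m + 1) + 1) * (m + 1).centralBinom ^ 2)
        = (2 * m + 3) * ((m + 1) * (m + 1).centralBinom) ^ 2 := by ring
      _ = 4 * (2 * m + 3) * (2 * m + 1) * ((2 * m + 1) * m.centralBinom ^ 2) := by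
          rw [hrec]; ring
      _ ≤ 4 * (2 * m + 3) * (2 * m + 1) * 16 ^ m := Nat.mul_le_mul_left _ ih
      _ ≤ 16 * (m + 1) ^ 2 * 16 ^ m := Nat.mul_le_mul_right _ (by nlinarith)
      _ = (m + 1) ^ 2 * 16 ^ (m + 1) := by ring

theorem succ_mul_choose_sq_le (d b : ℕ) : (d + 1) * d.choose b ^ 2 ≤ 4 ^ d := by
  have hmid : d.choose b ≤ d.choose (d / 2) := Nat.choose_le_middle b d
  refine (Nat.mul_le_mul_left _ (Nat.pow_le_pow_left hmid 2)).trans ?_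
  obtain ⟨m, rfl | rfl⟩ := Nat.even_or_odd' d
  · have h := two_mul_add_one_mul_centralBinom_sq_le m
    rw [Nat.centralBinom_eq_two_mul_choose] at h
    rw [Nat.mul_div_cancel_left m two_pos, pow_mul]
    exact h
  · have h := two_mul_add_one_mul_centralBinom_sq_le (m + 1)
    have hc : (m + 1).centralBinom = 2 * (2 * m + 1).choose m := by
      rw [Nat.centralBinom_eq_two_mul_choose, Nat.mul_add, mul_one, Nat.choose_succ_succ',
        Nat.choose_symm_half]; ring
    rw [hc] at h
    have hdiv : (2 * m + 1) / 2 = m := by omega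
    have hpow : 16 ^ (m + 1) = 4 * 4 ^ (2 * m + 1) := by
      rw [show (16 : ℕ) = 4 ^ 2 by norm_num, ← pow_mul]; ring
    rw [hdiv]
    rw [hpow] at h
    nlinarith

/-- A graph of maximum degree at most `D` on `s` has an independent set of size at least
`#s / (D + 1)`. -/
theorem exists_isClique_compl_card_le {V : Type*} (G : SimpleGraph V) (D : ℕ) (s : Finset V)
    (hs : ∀ y ∈ s, (s.filter fun z => G.Adj y z).card ≤ D) :
    ∃ t ⊆ s, Gᶜ.IsClique ↑t ∧ s.card ≤ t.card * (D + 1) := by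
  induction s using Finset.strongInduction with
  | H s ih =>
    obtain rfl | ⟨x, hx⟩ := s.eq_empty_or_nonempty
    · exact ⟨∅, by simp⟩
    set s' := s.filter fun z => ¬ (z = x ∨ G.Adj x z) with hs'
    have hsub : s' ⊆ s := filter_subset _ _
    have hxs' : x ∉ s' := by simp [hs']
    obtain ⟨t, hts, ht, hcard⟩ := ih s' ((ssubset_iff_of_subset hsub).2 ⟨x, hx, hxs'⟩)
      fun y hy => (card_le_card (filter_subset_filter _ hsub)).trans (hs y (hsub hy))
    have hxt : x ∉ t := fun h => hxs' (hts h)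
    refine ⟨insert x t, insert_subset hx (hts.trans hsub), ?_, ?_⟩
    · rw [coe_insert, SimpleGraph.isClique_insert]
      refine ⟨ht, fun y hy hxy => ?_⟩
      have hy' := hts (mem_coe.1 hy)
      simp only [hs', mem_filter, not_or] at hy'
      exact (G.compl_adj x y).2 ⟨hxy, hy'.2.2⟩
    · have hball : (s.filter fun z => z = x ∨ G.Adj x z).card ≤ D + 1 := by
        rw [filter_or, add_comm D]
        refine (card_union_le _ _).trans (Nat.add_le_add ?_ ?_)
        · exact card_le_one.2 fun a ha b hb => by
            rw [(mem_filter.1 ha).2, (mem_filter.1 hb).2]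
        · convert hs x hx
      have hsplit : (s.filter fun z => z = x ∨ G.Adj x z).card + s'.card = s.card := by
        rw [hs']
        convert card_filter_add_card_filter_not (s := s) fun z => z = x ∨ G.Adj x z
      rw [card_insert_of_notMem hxt, add_mul, one_mul]
      omega

theorem card_inter_sdiff_eq {V : Type*} {A B W : Finset V} (h : (W ∩ A).card = (W ∩ B).card) :
    (W ∩ (A \ B)).card = (W ∩ (B \ A)).card := by
  have h1 := card_sdiff_add_card_inter (W ∩ A) B
  have h2 := card_sdiff_add_card_inter (W ∩ B) A
  rw [inter_assoc, inter_sdiff_assoc] at h1 h2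
  rw [inter_comm B A] at h2
  omega

section

variable {V : Type*} [Fintype V] (G : SimpleGraph V)

theorem card_le_homNumber {s : Finset V} (hs : G.IsClique ↑s ∨ Gᶜ.IsClique ↑s) :
    s.card ≤ homNumber G :=
  le_csSup ⟨Fintype.card V, by rintro _ ⟨s, -, rfl⟩; exact s.card_le_univ⟩ ⟨s, hs, rfl⟩

theorem distinctDegrees_le_fNumber (s : Finset V) : distinctDegrees G s ≤ fNumber G :=
  le_csSup ⟨Fintype.card V, by
    rintro _ ⟨s, rfl⟩; exact card_image_le.trans s.card_le_univ⟩ ⟨s, rfl⟩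

theorem card_nbhdDist_le (x : V) (D : ℕ) :
    (univ.filter fun y => nbhdDist G x y ≤ D).card ≤ 2 * homNumber G * (D + 1) := by
  set B := univ.filter fun y => nbhdDist G x y ≤ D with hB
  have hnear : (B.filter fun y => G.Adj x y).card ≤ homNumber G * (D + 1) := by
    obtain ⟨t, -, ht, hcard⟩ :=
      exists_isClique_compl_card_le Gᶜ D (B.filter fun y => G.Adj x y) fun y hy => by
        simp only [hB, mem_filter, mem_univ, true_and] at hy
        refine (card_le_card fun z hz => ?_).trans hy.1
        simp only [mem_filter, SimpleGraph.compl_adj] at hz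
        simp only [mem_symmDiff, mem_erase, SimpleGraph.mem_neighborFinset]
        exact Or.inl ⟨⟨hz.2.1.symm, hz.1.2⟩, fun h => hz.2.2 h.2⟩
    rw [compl_compl] at ht
    exact hcard.trans (Nat.mul_le_mul_right _ (card_le_homNumber G (Or.inl ht)))
  have hfar : (B.filter fun y => ¬ G.Adj x y).card ≤ homNumber G * (D + 1) := by
    obtain ⟨t, -, ht, hcard⟩ :=
      exists_isClique_compl_card_le G D (B.filter fun y => ¬ G.Adj x y) fun y hy => by
        simp only [hB, mem_filter, mem_univ, true_and] at hy
        refine (card_le_card fun z hz => ?_).trans hy.1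
        simp only [mem_filter] at hz
        simp only [mem_symmDiff, mem_erase, SimpleGraph.mem_neighborFinset]
        refine Or.inr ⟨⟨?_, hz.2⟩, fun h => hz.1.2 h.2⟩
        rintro rfl
        exact hy.2 hz.2.symm
    exact hcard.trans (Nat.mul_le_mul_right _ (card_le_homNumber G (Or.inr ht)))
  have hsplit := card_filter_add_card_filter_not (s := B) fun y => G.Adj x y
  rw [mul_assoc]
  omega

/-- The vertex sets `W` containing `x` and `y`, and in which `x` and `y` have equal degrees. -/
noncomputable def equalDegreeSets (x y : V) : Finset (Finset V) :=
  univ.filter fun W => x ∈ W ∧ y ∈ W ∧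
    (W.filter fun z => G.Adj x z).card = (W.filter fun z => G.Adj y z).card

theorem card_equalDegreeSets_le (x y : V) :
    ∃ b, (equalDegreeSets G x y).card ≤
      2 ^ (Fintype.card V - nbhdDist G x y) * (nbhdDist G x y).choose b := by
  set X := (G.neighborFinset x).erase y with hX
  set Y := (G.neighborFinset y).erase x with hY
  have hδ : nbhdDist G x y = (symmDiff X Y).card := rfl
  refine ⟨(Y \ X).card, ?_⟩
  rw [hδ, ← card_compl, ← card_powerset, ← card_powersetCard, ← card_product]
  refine card_le_card_of_injOn
    (fun W => (W ∩ (symmDiff X Y)ᶜ, W ∩ (X \ Y) ∪ (Y \ X) \ W)) ?_ ?_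
  · intro W hW
    obtain ⟨hx, hy, hW⟩ : x ∈ W ∧ y ∈ W ∧
        (W.filter fun z => G.Adj x z).card = (W.filter fun z => G.Adj y z).card := by
      simpa [equalDegreeSets] using hW
    have hbal : (W ∩ X).card = (W ∩ Y).card := by
      have h1 : W ∩ X = (W.filter fun z => G.Adj x z).erase y := by
        ext z; simp [hX]; tauto
      have h2 : W ∩ Y = (W.filter fun z => G.Adj y z).erase x := by
        ext z; simp [hY]; tauto
      rw [h1, h2]
      by_cases hxy : G.Adj x y
      · rw [card_erase_of_mem (by simp [hy, hxy]), card_erase_of_mem (by simp [hx, hxy.symm]), hW]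
      · have hyx : ¬ G.Adj y x := fun h => hxy h.symm
        rw [erase_eq_of_notMem (by simp [hxy]), erase_eq_of_notMem (by simp [hyx]), hW]
    simp only [coe_product, Set.mem_prod, mem_coe, mem_powerset, mem_powersetCard]
    refine ⟨inter_subset_right, ?_, ?_⟩
    · intro z hz
      simp only [mem_union, mem_inter, mem_sdiff] at hz
      simp only [mem_symmDiff]
      tauto
    · rw [card_union_of_disjoint, card_inter_sdiff_eq hbal, inter_comm, add_comm]
      · exact card_sdiff_add_card_inter _ _
      · rw [Finset.disjoint_left]
        intro z hz
        simp only [mem_inter, mem_sdiff] at hz ⊢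
        tauto
  · intro W _ W' _ h
    simp only [Prod.mk.injEq] at h
    ext z
    have h1 := Finset.ext_iff.1 h.1 z
    have h2 := Finset.ext_iff.1 h.2 z
    simp only [mem_union, mem_inter, mem_sdiff, mem_compl, mem_symmDiff] at h1 h2
    clear * - h1 h2
    by_cases hX : z ∈ X <;> by_cases hY : z ∈ Y <;> simp_all [not_iff_not]

theorem card_equalDegreeSets_le_div_sqrt (x y : V) :
    ((equalDegreeSets G x y).card : ℝ) ≤
      2 ^ Fintype.card V * (1 / √((nbhdDist G x y + 1 : ℕ) : ℝ)) := by
  obtain ⟨b, hb⟩ := card_equalDegreeSets_le G x y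
  set d := nbhdDist G x y with hd
  have hdn : d ≤ Fintype.card V := card_le_univ _
  have hchoose : (d.choose b : ℝ) * √((d + 1 : ℕ) : ℝ) ≤ 2 ^ d := by
    refine le_of_sq_le_sq ?_ (by positivity)
    rw [mul_pow, Real.sq_sqrt (by positivity), ← pow_mul, mul_comm d, pow_mul, mul_comm]
    norm_num
    exact_mod_cast succ_mul_choose_sq_le d b
  have hb' : ((equalDegreeSets G x y).card : ℝ) ≤
      2 ^ (Fintype.card V - d) * (d.choose b : ℝ) := by exact_mod_cast hb
  rw [mul_one_div, le_div_iff₀ (by positivity)]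
  calc ((equalDegreeSets G x y).card : ℝ) * √((d + 1 : ℕ) : ℝ)
      ≤ 2 ^ (Fintype.card V - d) * (d.choose b : ℝ) * √((d + 1 : ℕ) : ℝ) := by gcongr
    _ ≤ 2 ^ (Fintype.card V - d) * 2 ^ d := by rw [mul_assoc]; gcongr
    _ = 2 ^ Fintype.card V := by rw [← pow_add, Nat.sub_add_cancel hdn]

end

/-- If at most `c * s` members of a family have `t ≤ s`, for every `s`, then `∑ 1 / √t` is
at most what it would be if the bounds were tight. -/
theorem sum_one_div_sqrt_le {α : Type*} (t : α → ℕ) (ht : ∀ a, 0 < t a) (c : ℕ) (S : Finset α)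
    (hS : ∀ s, (S.filter fun a => t a ≤ s).card ≤ c * s) :
    ∑ a ∈ S, 1 / √(t a : ℝ) ≤ 2 * √(c * S.card : ℝ) := by
  induction S using Finset.induction_on_max_value t with
  | empty => simp
  | insert a S ha hmax ih =>
    have hIH := ih fun s =>
      (card_le_card (filter_subset_filter _ (subset_insert a S))).trans (hS s)
    have hcard : S.card + 1 ≤ c * t a := by
      have h := hS (t a)
      rwa [filter_true_of_mem, card_insert_of_notMem ha] at h
      intro b hb
      obtain rfl | hb := mem_insert.1 hb
      exacts [le_rfl, hmax b hb]
    have hcard' : (S.card : ℝ) + 1 ≤ c * t a := by exact_mod_cast hcard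
    have hc : (0 : ℝ) < c := by
      have : 0 < c := Nat.pos_of_ne_zero fun h => by simp [h] at hcard
      exact_mod_cast this
    have hta : (0 : ℝ) < t a := by exact_mod_cast ht a
    rw [sum_insert ha, card_insert_of_notMem ha]
    push_cast
    set u := √(c * S.card : ℝ)
    set v := √(c * (S.card + 1) : ℝ)
    have hu : u ^ 2 = c * S.card := Real.sq_sqrt (by positivity)
    have hv : v ^ 2 = c * (S.card + 1) := Real.sq_sqrt (by positivity)
    have hu0 : 0 ≤ u := Real.sqrt_nonneg _
    have hv0 : 0 < v := Real.sqrt_pos.2 (by positivity)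
    have hvt : 1 / √(t a : ℝ) ≤ c / v := by
      rw [div_le_div_iff₀ (Real.sqrt_pos.2 hta) hv0, one_mul]
      refine le_of_sq_le_sq ?_ (by positivity)
      rw [mul_pow, Real.sq_sqrt hta.le, hv]
      nlinarith
    have hstep : c / v ≤ 2 * (v - u) := by
      rw [div_le_iff₀ hv0]
      nlinarith [sq_nonneg (v - u)]
    linarith

theorem card_sq_le_card_image_mul {α : Type*} (W : Finset α) (φ : α → ℕ) :
    W.card ^ 2 ≤ (W.image φ).card * ∑ x ∈ W, (W.filter fun y => φ x = φ y).card := by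
  have hpairs : ∑ x ∈ W, (W.filter fun y => φ x = φ y).card =
      ∑ d ∈ W.image φ, (W.filter fun y => φ y = d).card ^ 2 := by
    rw [← sum_fiberwise_of_maps_to fun x hx => mem_image_of_mem φ hx]
    refine sum_congr rfl fun d _ => ?_
    rw [sq, ← smul_eq_mul, ← sum_const]
    refine sum_congr rfl fun x hx => ?_
    rw [(mem_filter.1 hx).2]
    simp only [eq_comm]
  rw [hpairs, card_eq_sum_card_image φ W]
  exact sq_sum_le_card_mul_sum_sq

theorem sq_mul_two_pow_le_sum_card_sq (V : Type*) [Fintype V] :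
    Fintype.card V ^ 2 * 2 ^ Fintype.card V ≤ 4 * ∑ W : Finset V, W.card ^ 2 := by
  have hcompl : ∑ W : Finset V, W.card ^ 2 = ∑ W : Finset V, Wᶜ.card ^ 2 :=
    (Equiv.sum_comp (compl_involutive (α := Finset V)).toPerm fun W => W.card ^ 2).symm
  have hpt : ∑ _W : Finset V, Fintype.card V ^ 2 ≤
      ∑ W : Finset V, 2 * (W.card ^ 2 + Wᶜ.card ^ 2) :=
    sum_le_sum fun W _ => by
      rw [← card_add_card_compl W]
      zify
      nlinarith [sq_nonneg ((W.card : ℤ) - Wᶜ.card)]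
  rw [← mul_sum, sum_add_distrib, ← hcompl, sum_const, card_univ, Fintype.card_finset,
    smul_eq_mul] at hpt
  linarith

section

variable {V : Type*} [Fintype V] (G : SimpleGraph V)

theorem sum_card_sq_le :
    ∑ W : Finset V, W.card ^ 2 ≤
      fNumber G * ∑ x : V, ∑ y : V, (equalDegreeSets G x y).card := by
  have hcount : ∑ x : V, ∑ y : V, (equalDegreeSets G x y).card =
      ∑ W : Finset V, ∑ x ∈ W, (W.filter fun y =>
        (W.filter fun z => G.Adj x z).card = (W.filter fun z => G.Adj y z).card).card := by
    simp only [equalDegreeSets, card_filter, ite_and]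
    rw [sum_congr rfl fun x _ => sum_comm, sum_comm]
    refine sum_congr rfl fun W _ => ?_
    rw [← sum_filter_add_sum_filter_not univ (· ∈ W)]
    simp
  rw [hcount, mul_sum]
  exact sum_le_sum fun W _ => (card_sq_le_card_image_mul W _).trans
    (Nat.mul_le_mul_right _ (distinctDegrees_le_fNumber G W))

theorem sum_one_div_sqrt_nbhdDist_le (x : V) :
    ∑ y : V, 1 / √((nbhdDist G x y + 1 : ℕ) : ℝ) ≤
      2 * √((2 * homNumber G : ℕ) * Fintype.card V : ℝ) := by
  refine sum_one_div_sqrt_le (fun y => nbhdDist G x y + 1) (fun y => Nat.succ_pos _) _ univ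
    fun s => ?_
  cases s with
  | zero => simp
  | succ D => simpa using card_nbhdDist_le G x D

theorem card_le_fNumber_mul_sqrt :
    (Fintype.card V : ℝ) ≤
      8 * fNumber G * √((2 * homNumber G : ℕ) * Fintype.card V : ℝ) := by
  set n := Fintype.card V with hn
  set r := √((2 * homNumber G : ℕ) * n : ℝ)
  obtain h0 | hpos := Nat.eq_zero_or_pos n
  · rw [h0, Nat.cast_zero]; positivity
  have hlow : (n : ℝ) ^ 2 * 2 ^ n ≤ 4 * (fNumber G *
      ∑ x : V, ∑ y : V, ((equalDegreeSets G x y).card : ℝ)) := by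
    exact_mod_cast (sq_mul_two_pow_le_sum_card_sq V).trans
      (Nat.mul_le_mul_left 4 (sum_card_sq_le G))
  have hup : ∑ x : V, ∑ y : V, ((equalDegreeSets G x y).card : ℝ) ≤ n * (2 ^ n * (2 * r)) := by
    rw [← nsmul_eq_mul]
    refine sum_le_card_nsmul univ _ _ fun x _ => ?_
    refine (sum_le_sum fun y _ => card_equalDegreeSets_le_div_sqrt G x y).trans ?_
    rw [← mul_sum]
    gcongr
    exact sum_one_div_sqrt_nbhdDist_le G x
  have hn0 : (0 : ℝ) < n * 2 ^ n := by positivity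
  refine le_of_mul_le_mul_left ?_ hn0
  calc (n : ℝ) * 2 ^ n * n = (n : ℝ) ^ 2 * 2 ^ n := by ring
    _ ≤ 4 * (fNumber G * (n * (2 ^ n * (2 * r)))) := hlow.trans (by gcongr)
    _ = n * 2 ^ n * (8 * fNumber G * r) := by ring

end

/-- Every graph `G` on `n ≥ 1` vertices satisfies `f(G) ≥ (1/250)·√(n/hom(G))`. -/
theorem stmt_0 (n : ℕ) (hn : 1 ≤ n) (G : SimpleGraph (Fin n)) :
    (fNumber G : ℝ) ≥ (1 / 250) * Real.sqrt ((n : ℝ) / (homNumber G : ℝ)) := by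
  have hmain := card_le_fNumber_mul_sqrt G
  rw [Fintype.card_fin] at hmain
  push_cast at hmain
  have hhom : 1 ≤ homNumber G := by
    simpa using card_le_homNumber G (s := {(⟨0, hn⟩ : Fin n)}) (Or.inl (by simp))
  have hh : (0 : ℝ) < homNumber G := by exact_mod_cast hhom
  set h : ℝ := (homNumber G : ℝ)
  have hn0 : (0 : ℝ) < n := by exact_mod_cast hn
  set F : ℝ := (fNumber G : ℝ)
  have hF : 0 ≤ F := Nat.cast_nonneg _
  have hsq : (n : ℝ) ^ 2 ≤ 64 * F ^ 2 * (2 * h * n) := by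
    calc (n : ℝ) ^ 2 ≤ (8 * F * √(2 * h * n)) ^ 2 := by gcongr
      _ = 64 * F ^ 2 * (2 * h * n) := by
        rw [mul_pow, Real.sq_sqrt (by positivity)]; ring
  have hlin : (n : ℝ) ≤ 128 * F ^ 2 * h := by
    refine le_of_mul_le_mul_right ?_ hn0
    linarith
  have hroot : √((n : ℝ) / h) ≤ 250 * F := by
    refine Real.sqrt_le_iff.2 ⟨by positivity, ?_⟩
    rw [div_le_iff₀ hh]
    nlinarith [mul_nonneg (sq_nonneg F) hh.le]
  linarith
end

section
/- Fix a positive integer k and a real ε > 0. There exists N = N(k,ε) such that for every n ≥ N, every finite simple graph G on n vertices with hom(G) < n/(k-1+ε) satisfies f(G) ≥ k. -/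
open Finset
open scoped Classical

section Degrees

variable {V : Type*} [Fintype V] (G : SimpleGraph V)

/-- Superincreasing weights: subset sums determine the subset. -/
theorem exists_weights {ι : Type*} (J : Finset ι) :
    ∃ w : ι → ℕ, (∀ j ∈ J, w j ≤ 2 ^ J.card) ∧
      ∀ A ⊆ J, ∀ B ⊆ J, ∑ j ∈ A, w j = ∑ j ∈ B, w j → A = B := by
  let e : ι → ℕ := fun j => if h : j ∈ J then (J.equivFin ⟨j, h⟩ : ℕ) else 0
  have he : Set.InjOn e J := by
    intro a ha b hb hab
    have ha' : a ∈ J := ha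
    have hb' : b ∈ J := hb
    simp only [e, ha', hb', dif_pos] at hab
    simpa using J.equivFin.injective (Fin.ext hab)
  refine ⟨fun j => 2 ^ e j, fun j hj => ?_, fun A hA B hB h => ?_⟩
  · have : e j < J.card := by simp [e, hj]
    exact Nat.pow_le_pow_right (by norm_num) this.le
  · have hs : ∀ A ⊆ J, ∑ j ∈ A, 2 ^ e j = ∑ i ∈ A.image e, 2 ^ i := fun A hA =>
      (sum_image (f := fun i => 2 ^ i) (he.mono (by exact_mod_cast hA))).symm
    simp only [hs A hA, hs B hB] at h
    have := Finset.geomSum_injective (n := 2) le_rfl h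
    have h2 := congrArg (fun s : Finset ℕ => (s : Set ℕ)) this
    simp only [coe_image] at h2
    exact_mod_cast (he.image_eq_image_iff (by exact_mod_cast hA) (by exact_mod_cast hB)).1 h2

/-- Vertices that see each of many large pools either fully or not at all, and that are told apart
either by these pools or by their degrees in `X`, get distinct degrees in an induced subgraph. -/
theorem card_le_fNumber_of_pools {ι : Type*} {X X₀ : Finset V} (hX : X₀ ⊆ X) (J : Finset ι)
    (A : ι → Finset V) (τ : V → Finset ι) (hτ : ∀ x ∈ X₀, τ x ⊆ J)
    (hA : ∀ j ∈ J, X.card * 2 ^ J.card ≤ (A j).card)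
    (hdisj : ∀ i ∈ J, ∀ j ∈ J, i ≠ j → Disjoint (A i) (A j))
    (hAX : ∀ j ∈ J, Disjoint (A j) X)
    (hadj : ∀ x ∈ X₀, ∀ j ∈ J, ∀ y ∈ A j, (G.Adj x y ↔ j ∈ τ x))
    (hinj : ∀ x ∈ X₀, ∀ x' ∈ X₀, τ x = τ x' →
      (X.filter (G.Adj x)).card = (X.filter (G.Adj x')).card → x = x') :
    X₀.card ≤ fNumber G := by
  obtain ⟨w, hw, hwinj⟩ := exists_weights J
  have hU : ∀ j, ∃ U : Finset V, j ∈ J → U ⊆ A j ∧ U.card = X.card * w j := by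
    intro j
    by_cases hj : j ∈ J
    · obtain ⟨U, hU, hUc⟩ := exists_subset_card_eq
        ((Nat.mul_le_mul_left X.card (hw j hj)).trans (hA j hj))
      exact ⟨U, fun _ => ⟨hU, hUc⟩⟩
    · exact ⟨∅, fun h => absurd h hj⟩
  choose U hU using hU
  let W := X ∪ J.biUnion U
  have hdeg : ∀ x ∈ X₀, (W.filter (G.Adj x)).card
      = (X.filter (G.Adj x)).card + X.card * ∑ j ∈ τ x, w j := by
    intro x hx
    have hfil : (J.biUnion U).filter (G.Adj x) = (τ x).biUnion U := by
      ext y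
      simp only [mem_filter, mem_biUnion]
      constructor
      · rintro ⟨⟨j, hj, hy⟩, hxy⟩
        exact ⟨j, (hadj x hx j hj y ((hU j hj).1 hy)).1 hxy, hy⟩
      · rintro ⟨j, hj, hy⟩
        have hjJ := hτ x hx hj
        exact ⟨⟨j, hjJ, hy⟩, (hadj x hx j hjJ y ((hU j hjJ).1 hy)).2 hj⟩
    have hXU : Disjoint X (J.biUnion U) := by
      rw [disjoint_biUnion_right]
      intro j hj
      exact ((hAX j hj).mono_left (hU j hj).1).symm
    rw [show W = X ∪ J.biUnion U from rfl, filter_union,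
      card_union_of_disjoint (hXU.mono (filter_subset _ _) (filter_subset _ _)), hfil,
      card_biUnion, mul_sum]
    · congr 1
      exact sum_congr rfl fun j hj => (hU j (hτ x hx hj)).2
    · intro i hi j hj hij
      exact (hdisj i (hτ x hx hi) j (hτ x hx hj) hij).mono (hU i (hτ x hx hi)).1
        (hU j (hτ x hx hj)).1
  have hlt : ∀ x ∈ X₀, (X.filter (G.Adj x)).card < X.card := by
    intro x hx
    refine card_lt_card ⟨filter_subset _ _, fun h => ?_⟩
    exact G.loopless.irrefl x (mem_filter.1 (h (hX hx))).2
  refine le_trans ?_ (distinctDegrees_le_fNumber G W)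
  rw [distinctDegrees, ← card_image_of_injOn (s := X₀)
    (f := fun x => (W.filter fun y => G.Adj x y).card)]
  · exact card_le_card (image_subset_image (hX.trans subset_union_left))
  · intro x hx x' hx' h
    have h' : (W.filter (G.Adj x)).card = (W.filter (G.Adj x')).card := h
    rw [hdeg x hx, hdeg x' hx'] at h'
    have h1 := hlt x hx
    have h2 := hlt x' hx'
    have hmod := congrArg (· % X.card) h'
    have hdiv := congrArg (· / X.card) h'
    simp only [Nat.add_mul_mod_self_left, Nat.mod_eq_of_lt h1, Nat.mod_eq_of_lt h2] at hmod
    simp only [Nat.add_mul_div_left _ _ (Nat.zero_lt_of_lt h1), Nat.div_eq_of_lt h1,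
      Nat.div_eq_of_lt h2, zero_add] at hdiv
    exact hinj x hx x' hx' (hwinj _ (hτ x hx) _ (hτ x' hx') hdiv) hmod

end Degrees

section Distance

variable {V : Type*} [Fintype V] (G : SimpleGraph V)

/-- The size of the symmetric difference of two neighbourhoods. -/
noncomputable def adjDist (x y : V) : ℕ :=
  (univ.filter fun z => ¬(G.Adj x z ↔ G.Adj y z)).card

theorem adjDist_self (x : V) : adjDist G x x = 0 := by
  simp [adjDist]

theorem adjDist_comm (x y : V) : adjDist G x y = adjDist G y x := by
  simp only [adjDist, iff_comm]

theorem adjDist_triangle (x y z : V) : adjDist G x z ≤ adjDist G x y + adjDist G y z := by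
  refine le_trans (card_le_card ?_) (card_union_le _ _)
  intro w
  simp only [mem_filter, mem_univ, true_and, mem_union]
  tauto

/-- `S` is separated at scale `F D`, where `D` is the covering radius, unless `S` is as large as
requested. -/
theorem exists_separated_dense {V : Type*} (d : V → V → ℕ) (hself : ∀ x, d x x = 0)
    (hcomm : ∀ x y, d x y = d y x) (F : ℕ → ℕ) (hF : ∀ D, D ≤ F D) (i : ℕ) :
    ∀ S : Finset V, (∀ x ∈ S, ∀ y ∈ S, x ≠ y → F^[i + 1] 0 < d x y) →
      ∃ m ≤ i, ∃ S' : Finset V, S'.card ≤ S.card + i ∧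
        (∀ x ∈ S', ∀ y ∈ S', x ≠ y → F (F^[m] 0) < d x y) ∧
        (S'.card = S.card + i ∨ ∀ v, ∃ x ∈ S', d v x ≤ F^[m] 0) := by
  induction i with
  | zero => exact fun S hS => ⟨0, le_rfl, S, le_rfl, hS, Or.inl rfl⟩
  | succ i ih =>
    intro S hS
    by_cases hdense : ∀ v, ∃ x ∈ S, d v x ≤ F^[i + 1] 0
    · refine ⟨i + 1, le_rfl, S, by omega, ?_, Or.inr hdense⟩
      simpa only [Function.iterate_succ_apply'] using hS
    · push Not at hdense
      obtain ⟨v, hv⟩ := hdense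
      have hvS : v ∉ S := fun h => by have := hv v h; simp [hself] at this
      have hle : F^[i + 1] 0 ≤ F^[i + 1 + 1] 0 := by
        rw [Function.iterate_succ_apply' F (i + 1)]
        exact hF _
      obtain ⟨m, hm, S', hc, hsep, h⟩ := ih (insert v S) (by
        intro x hx y hy hxy
        rcases mem_insert.1 hx with hxv | hxS <;> rcases mem_insert.1 hy with hyv | hyS
        · exact absurd (hxv.trans hyv.symm) hxy
        · exact hxv ▸ hv y hyS
        · rw [hcomm]; exact hyv ▸ hv x hxS
        · exact hle.trans_lt (hS x hxS y hyS hxy))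
      rw [card_insert_of_notMem hvS] at hc h
      exact ⟨m, by omega, S', by omega, hsep, h.imp_left fun h => by omega⟩

/-- Pairwise far vertices can be given distinct degrees. -/
theorem card_le_fNumber_of_separated (S : Finset V)
    (hS : ∀ x ∈ S, ∀ y ∈ S, x ≠ y →
      S.card + 2 ^ S.card * (S.card * 2 ^ 2 ^ S.card) < adjDist G x y) :
    S.card ≤ fNumber G := by
  let A : Finset V → Finset V := fun T =>
    univ.filter fun z => z ∉ S ∧ S.filter (fun x => G.Adj x z) = T
  let J := S.powerset.filter fun T => S.card * 2 ^ 2 ^ S.card ≤ (A T).card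
  have hJ : J.card ≤ 2 ^ S.card := by
    rw [← card_powerset]
    exact card_filter_le _ _
  refine card_le_fNumber_of_pools G (subset_refl S) J A (fun x => J.filter fun T => x ∈ T)
    (fun x _ => filter_subset _ _) ?_ ?_ ?_ ?_ ?_
  · intro T hT
    refine le_trans ?_ (mem_filter.1 hT).2
    exact Nat.mul_le_mul_left _ (Nat.pow_le_pow_right (by norm_num) hJ)
  · intro T _ T' _ hne
    rw [disjoint_left]
    intro z hz hz'
    simp only [A, mem_filter, mem_univ, true_and] at hz hz'
    exact hne (hz.2.symm.trans hz'.2)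
  · intro T _
    rw [disjoint_left]
    intro z hz
    simp only [A, mem_filter, mem_univ, true_and] at hz
    exact hz.1
  · intro x hx T hT z hz
    simp only [A, mem_filter, mem_univ, true_and] at hz
    simp only [mem_filter, hT, true_and]
    rw [← hz.2]
    simp [hx]
  · intro x hx y hy hxy _
    by_contra hne
    refine absurd (hS x hx y hy hne) (not_lt.2 ?_)
    have hsub : (univ.filter fun z => ¬(G.Adj x z ↔ G.Adj y z)) ⊆
        S ∪ (S.powerset \ J).biUnion A := by
      intro z hz
      simp only [mem_filter, mem_univ, true_and] at hz
      rw [mem_union, or_iff_not_imp_left]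
      intro hzS
      refine mem_biUnion.2 ⟨S.filter (fun x => G.Adj x z), ?_, by simp [A, hzS]⟩
      refine mem_sdiff.2 ⟨mem_powerset.2 (filter_subset _ _), fun hJz => hz ?_⟩
      have := Finset.ext_iff.1 hxy (S.filter (fun x => G.Adj x z))
      simpa [hJz, hx, hy] using this
    refine (card_le_card hsub).trans ((card_union_le _ _).trans (Nat.add_le_add_left ?_ _))
    refine (card_biUnion_le_card_mul _ _ (S.card * 2 ^ 2 ^ S.card) ?_).trans
      (Nat.mul_le_mul_right _ ?_)
    · intro T hT
      by_contra hlt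
      rw [mem_sdiff] at hT
      exact hT.2 (mem_filter.2 ⟨hT.1, (not_le.1 hlt).le⟩)
    · rw [← card_powerset]
      exact card_le_card sdiff_subset

end Distance

section BoundedDegree

variable {V : Type*}

/-- Large enough sets admit representatives avoiding a relation of bounded degree. -/
theorem exists_unrelated_representatives {ι : Type*} [Fintype V] [Nonempty V] (R : V → V → Prop)
    (hsymm : ∀ v w, R v w → R w v) (d : ℕ) (hR : ∀ v, (univ.filter (R v)).card ≤ d)
    (Z : ι → Finset V) (I : Finset ι) (hZ : ∀ p ∈ I, d * I.card < (Z p).card) :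
    ∃ x : ι → V, (∀ p ∈ I, x p ∈ Z p) ∧ ∀ p ∈ I, ∀ q ∈ I, p ≠ q → ¬R (x p) (x q) := by
  induction I using Finset.induction_on with
  | empty => exact ⟨fun _ => Classical.arbitrary V, by simp, by simp⟩
  | insert a I ha ih =>
    rw [card_insert_of_notMem ha] at hZ
    obtain ⟨x, hx, hxR⟩ := ih fun p hp =>
      (Nat.mul_le_mul_left d (Nat.le_succ _)).trans_lt (hZ p (mem_insert_of_mem hp))
    have hbad : (I.biUnion fun q => univ.filter (R (x q))).card < (Z a).card := by
      refine (card_biUnion_le_card_mul _ _ d fun q _ => hR _).trans_lt ?_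
      rw [mul_comm]
      exact (Nat.mul_le_mul_left d (Nat.le_succ _)).trans_lt (hZ a (mem_insert_self a I))
    obtain ⟨v, hv, hvbad⟩ := exists_mem_notMem_of_card_lt_card hbad
    simp only [mem_biUnion, mem_filter, mem_univ, true_and, not_exists, not_and] at hvbad
    have hne : ∀ p ∈ I, p ≠ a := fun p hp h => ha (h ▸ hp)
    refine ⟨Function.update x a v, fun p hp => ?_, fun p hp q hq hpq => ?_⟩
    · rcases mem_insert.1 hp with h | h
      · subst h; simpa using hv
      · simpa [hne p h] using hx p h
    · rcases mem_insert.1 hp with h | h <;> rcases mem_insert.1 hq with h' | h'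
      · exact absurd (h.trans h'.symm) hpq
      · subst h
        simpa [hne q h'] using fun hvq => hvbad q h' (hsymm _ _ hvq)
      · subst h'
        simpa [hne p h] using hvbad p h
      · simpa [hne p h, hne q h'] using hxR p h q h' hpq

theorem exists_independent_of_degree_le (H : V → V → Prop) (hsymm : ∀ v w, H v w → H w v)
    (hirr : ∀ v, ¬H v v) (u : ℕ) (C : Finset V) (hC : ∀ x ∈ C, (C.filter (H x)).card ≤ u) :
    ∃ I ⊆ C, (∀ x ∈ I, ∀ y ∈ I, ¬H x y) ∧ C.card ≤ (u + 1) * I.card := by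
  induction C using Finset.strongInduction with
  | H C ih =>
    rcases C.eq_empty_or_nonempty with rfl | ⟨x, hx⟩
    · exact ⟨∅, by simp⟩
    let C' := C.filter fun y => y ≠ x ∧ ¬H x y
    have hC' : C' ⊆ C := filter_subset _ _
    have hlt : C' ⊂ C := ⟨hC', fun h => (mem_filter.1 (h hx)).2.1 rfl⟩
    obtain ⟨I, hI, hind, hcard⟩ := ih C' hlt fun y hy =>
      (card_le_card (filter_subset_filter _ hC')).trans (hC y (hC' hy))
    have hmem : ∀ y ∈ I, y ≠ x ∧ ¬H x y := fun y hy => (mem_filter.1 (hI hy)).2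
    have hxI : x ∉ I := fun h => (hmem x h).1 rfl
    refine ⟨insert x I, insert_subset hx (hI.trans hC'), ?_, ?_⟩
    · intro y hy z hz
      rcases mem_insert.1 hy with h | h <;> rcases mem_insert.1 hz with h' | h'
      · rw [h, h']; exact hirr x
      · rw [h]; exact (hmem z h').2
      · rw [h']; exact fun hyx => (hmem y h).2 (hsymm _ _ hyx)
      · exact hind y h z h'
    · have hsub : C ⊆ C' ∪ insert x (C.filter (H x)) := by
        intro y hy
        simp only [C', mem_union, mem_insert, mem_filter]
        tauto
      have h1 := (card_le_card hsub).trans (card_union_le _ _)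
      have h2 := card_insert_le x (C.filter (H x))
      have h3 := hC x hx
      rw [card_insert_of_notMem hxI, mul_add]
      omega

theorem exists_last_frequent_value {C : Finset V} (f : V → ℕ) {M Δ : ℕ} (hM : 0 < M)
    (hC : M ≤ C.card) (hf : ∀ x ∈ C, f x ≤ Δ) :
    ∃ u ≤ Δ, M ≤ (C.filter fun x => u ≤ f x).card ∧ (C.filter fun x => ¬f x ≤ u).card < M := by
  have hP : ∃ u, (C.filter fun x => ¬f x ≤ u).card < M :=
    ⟨Δ, by rwa [filter_false_of_mem fun x hx => not_not.2 (hf x hx), card_empty]⟩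
  refine ⟨Nat.find hP, ?_, ?_, Nat.find_spec hP⟩
  · apply Nat.find_min'
    rwa [filter_false_of_mem fun x hx => not_not.2 (hf x hx), card_empty]
  · rcases h : Nat.find hP with _ | v
    · simpa using hC
    · have h1 := Nat.find_min hP (m := v) (by omega)
      simpa [Nat.succ_le_iff] using h1

end BoundedDegree

section Clusters

variable {V : Type*} (G : SimpleGraph V)

/-- Between two clusters of small diameter the graph is almost complete or almost empty. -/
theorem exists_almost_uniform [Fintype V] {C C' : Finset V} {K : ℕ}
    (hC : ∀ x ∈ C, ∀ y ∈ C, adjDist G x y ≤ K) (hC' : ∀ x ∈ C', ∀ y ∈ C', adjDist G x y ≤ K)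
    (hcard : 2 * K < C.card) :
    ∃ s : Prop, ∀ x ∈ C, (C'.filter fun y => ¬(G.Adj x y ↔ s)).card ≤ 3 * K := by
  obtain ⟨x₀, hx₀⟩ := card_pos.1 (Nat.zero_lt_of_lt hcard)
  have hdiff : ∀ x ∈ C, (C'.filter fun y => ¬(G.Adj x y ↔ G.Adj x₀ y)).card ≤ K := fun x hx =>
    (card_le_card (filter_subset_filter _ (subset_univ _))).trans (hC x hx x₀ hx₀)
  suffices h : ∃ s : Prop, (C'.filter fun y => ¬(G.Adj x₀ y ↔ s)).card ≤ 2 * K by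
    obtain ⟨s, hs⟩ := h
    refine ⟨s, fun x hx => ?_⟩
    have hsub : (C'.filter fun y => ¬(G.Adj x y ↔ s)) ⊆
        (C'.filter fun y => ¬(G.Adj x y ↔ G.Adj x₀ y)) ∪
          C'.filter fun y => ¬(G.Adj x₀ y ↔ s) := by
      intro y
      simp only [mem_filter, mem_union]
      tauto
    have := (card_le_card hsub).trans (card_union_le _ _)
    have := hdiff x hx
    omega
  by_contra hno
  push Not at hno
  let A := C'.filter fun y => G.Adj x₀ y
  let B := C'.filter fun y => ¬G.Adj x₀ y
  have hA : 2 * K < A.card := by simpa [A] using hno False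
  have hB : 2 * K < B.card := by simpa [B] using hno True
  let e : V → ℕ := fun y => (C.filter fun x => G.Adj x y).card
  have hcount : ∑ y ∈ A, (C.filter fun x => ¬G.Adj x y).card + ∑ y ∈ B, e y ≤ C.card * K := by
    have h1 : ∑ y ∈ A, (C.filter fun x => ¬G.Adj x y).card
        = ∑ x ∈ C, (A.filter fun y => ¬G.Adj x y).card :=
      (sum_card_bipartiteAbove_eq_sum_card_bipartiteBelow fun x y => ¬G.Adj x y).symm
    have h2 : ∑ y ∈ B, e y = ∑ x ∈ C, (B.filter fun y => G.Adj x y).card :=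
      (sum_card_bipartiteAbove_eq_sum_card_bipartiteBelow fun x y => G.Adj x y).symm
    rw [h1, h2, ← sum_add_distrib]
    refine sum_le_card_nsmul _ _ _ fun x hx => le_trans ?_ (hdiff x hx)
    rw [← card_union_of_disjoint]
    · refine card_le_card fun y => ?_
      simp only [A, B, mem_filter, mem_union]
      tauto
    · rw [disjoint_left]
      intro y
      simp only [mem_filter]
      tauto
  have hlip : ∀ y ∈ C', ∀ y' ∈ C', e y ≤ e y' + K := by
    intro y hy y' hy'
    refine le_trans ?_ (Nat.add_le_add_left (hC' y hy y' hy') _)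
    refine le_trans (card_le_card ?_) (card_union_le _ _)
    intro x
    simp only [mem_filter, mem_union, mem_univ, true_and, G.adj_comm x]
    tauto
  obtain ⟨b, hb, hmin⟩ := exists_min_image B e (card_pos.1 (Nat.zero_lt_of_lt hB))
  have hlowA : A.card * (C.card - e b - K) ≤ ∑ y ∈ A, (C.filter fun x => ¬G.Adj x y).card := by
    refine card_nsmul_le_sum _ _ _ fun y hy => ?_
    have h1 := hlip y (mem_filter.1 hy).1 b (mem_filter.1 hb).1
    have h2 : e y + (C.filter fun x => ¬G.Adj x y).card = C.card :=
      card_filter_add_card_filter_not _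
    omega
  have hlowB : B.card * e b ≤ ∑ y ∈ B, e y := card_nsmul_le_sum _ _ _ hmin
  have h1 : (2 * K + 1) * (C.card - e b - K) ≤ A.card * (C.card - e b - K) :=
    Nat.mul_le_mul_right _ hA
  have h2 : (2 * K + 1) * e b ≤ B.card * e b := Nat.mul_le_mul_right _ hB
  have h3 : (2 * K + 1) * (C.card - K) ≤ (2 * K + 1) * (C.card - e b - K + e b) :=
    Nat.mul_le_mul_left _ (by omega)
  obtain ⟨r, hr⟩ := Nat.exists_eq_add_of_lt hcard
  rw [show C.card - K = K + r + 1 by omega] at h3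
  rw [hr] at hcount
  nlinarith

theorem almost_uniform_symm {C C' : Finset V} {m : ℕ} {s s' : Prop}
    (hs : ∀ x ∈ C, (C'.filter fun y => ¬(G.Adj x y ↔ s)).card ≤ m)
    (hs' : ∀ y ∈ C', (C.filter fun x => ¬(G.Adj y x ↔ s')).card ≤ m)
    (hC : 2 * m < C.card) (hC' : 2 * m < C'.card) : s ↔ s' := by
  by_contra hne
  have h : ∑ x ∈ C, C'.card ≤ ∑ x ∈ C, ((C'.filter fun y => ¬(G.Adj x y ↔ s)).card
      + (C'.filter fun y => ¬(G.Adj y x ↔ s')).card) := by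
    refine sum_le_sum fun x _ => le_trans (card_le_card ?_) (card_union_le _ _)
    intro y hy
    simp only [mem_filter, mem_union, hy, true_and, G.adj_comm y x]
    tauto
  have h2 : ∑ x ∈ C, (C'.filter fun y => ¬(G.Adj y x ↔ s')).card
      = ∑ y ∈ C', (C.filter fun x => ¬(G.Adj y x ↔ s')).card :=
    sum_card_bipartiteAbove_eq_sum_card_bipartiteBelow fun x y => ¬(G.Adj y x ↔ s')
  rw [sum_add_distrib, h2, sum_const, smul_eq_mul] at h
  have h3 := sum_le_card_nsmul _ _ _ hs
  have h4 := sum_le_card_nsmul _ _ _ hs'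
  rw [smul_eq_mul] at h3 h4
  nlinarith

/-- The pair `x`, `y` deviates from the pattern `s` of the clusters (the fibres of `c` over `J`). -/
def Exceptional (c : V → V) (J : Finset V) (s : V → V → Prop) (x y : V) : Prop :=
  c x ∈ J ∧ c y ∈ J ∧ x ≠ y ∧ ¬(G.Adj x y ↔ s (c x) (c y))

variable [Fintype V]

/-- If each cluster has many vertices of exceptional degree at least `u i`, then `u i + 1` distinct
degrees can be found in each cluster, simultaneously. -/
theorem sum_le_fNumber_of_exceptional [Nonempty V] (c : V → V) (J : Finset V)
    (s : V → V → Prop) (k Δ : ℕ) (hJ : J.card ≤ k)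
    (hsymm : ∀ i ∈ J, ∀ j ∈ J, (s i j ↔ s j i))
    (hrow : ∀ i ∈ J, ∀ j ∈ J, (∀ l ∈ J, s i l ↔ s j l) → i = j)
    (hΔ : ∀ x, (univ.filter (Exceptional G c J s x)).card ≤ Δ)
    (u : V → ℕ) (hu : ∀ i ∈ J, u i ≤ Δ)
    (hmany : ∀ i ∈ J, (1 + Δ + Δ * Δ) * (k * (Δ + 1)) <
      (univ.filter fun x => c x = i ∧
        u i ≤ (univ.filter fun y => c y = i ∧ Exceptional G c J s x y).card).card)
    (hlarge : ∀ i ∈ J, k * (Δ + 1) * (Δ + 1) * (2 ^ k + Δ + 1) ≤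
      (univ.filter fun x => c x = i).card) :
    ∑ i ∈ J, (u i + 1) ≤ fNumber G := by
  set H := Exceptional G c J s with hH
  have hHsymm : ∀ v w, H v w → H w v := by
    rintro v w ⟨h1, h2, h3, h4⟩
    refine ⟨h2, h1, h3.symm, ?_⟩
    rwa [G.adj_comm, hsymm _ h2 _ h1]
  have hHirr : ∀ v, ¬H v v := fun v h => h.2.2.1 rfl
  let R : V → V → Prop := fun v w => v = w ∨ H v w ∨ ∃ y, H v y ∧ H y w
  have hRsymm : ∀ v w, R v w → R w v := by
    rintro v w (h | h | ⟨y, h, h'⟩)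
    · exact Or.inl h.symm
    · exact Or.inr (Or.inl (hHsymm _ _ h))
    · exact Or.inr (Or.inr ⟨y, hHsymm _ _ h', hHsymm _ _ h⟩)
  have hRdeg : ∀ v, (univ.filter (R v)).card ≤ 1 + Δ + Δ * Δ := by
    intro v
    have hsub : univ.filter (R v) ⊆ {v} ∪ univ.filter (H v) ∪
        (univ.filter (H v)).biUnion fun y => univ.filter (H y) := by
      intro w
      simp only [R, mem_filter, mem_univ, true_and, mem_union, mem_singleton, mem_biUnion]
      rintro (h | h | h)
      · exact Or.inl (Or.inl h.symm)
      · exact Or.inl (Or.inr h)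
      · exact Or.inr h
    refine (card_le_card hsub).trans ((card_union_le _ _).trans (add_le_add ?_ ?_))
    · refine (card_union_le _ _).trans (add_le_add (card_singleton v).le (hΔ v))
    · exact (card_biUnion_le_card_mul _ _ Δ fun y _ => hΔ y).trans (Nat.mul_le_mul_right _ (hΔ v))
  let I : Finset (Σ _ : V, ℕ) := J.sigma fun i => range (u i + 1)
  have hI : I.card = ∑ i ∈ J, (u i + 1) := by simp [I]
  have hIk : I.card ≤ k * (Δ + 1) := by
    rw [hI]
    refine (sum_le_card_nsmul _ _ (Δ + 1) fun i hi => by have := hu i hi; omega).trans ?_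
    exact Nat.mul_le_mul_right _ hJ
  have hImem : ∀ p ∈ I, p.1 ∈ J ∧ p.2 ≤ u p.1 := by
    intro p hp
    simpa [I, Nat.lt_succ_iff] using hp
  obtain ⟨x, hxZ, hxR⟩ := exists_unrelated_representatives R hRsymm _
    (fun v => by convert hRdeg v)
    (fun p : Σ _ : V, ℕ => univ.filter fun x => c x = p.1 ∧
      u p.1 ≤ (univ.filter fun y => c y = p.1 ∧ H x y).card) I
    fun p hp => (Nat.mul_le_mul_left _ hIk).trans_lt (hmany p.1 (hImem p hp).1)
  simp only [mem_filter, mem_univ, true_and] at hxZ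
  have hY : ∀ p : Σ _ : V, ℕ, ∃ Y : Finset V, p ∈ I →
      (∀ y ∈ Y, c y = p.1 ∧ H (x p) y) ∧ Y.card = p.2 := by
    intro p
    by_cases hp : p ∈ I
    · obtain ⟨Y, hY, hYc⟩ := exists_subset_card_eq ((hImem p hp).2.trans (hxZ p hp).2)
      exact ⟨Y, fun _ => ⟨fun y hy => (mem_filter.1 (hY hy)).2, hYc⟩⟩
    · exact ⟨∅, fun h => absurd h hp⟩
  choose Y hY using hY
  have hxinj : ∀ p ∈ I, ∀ q ∈ I, x p = x q → p = q := by
    intro p hp q hq h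
    by_contra hne
    exact hxR p hp q hq hne (Or.inl h)
  let X₀ := I.image x
  let X := X₀ ∪ I.biUnion Y
  have hX₀ : X₀.card = I.card := card_image_of_injOn fun p hp q hq h => hxinj p hp q hq h
  have hXcard : X.card ≤ k * (Δ + 1) * (Δ + 1) := by
    refine (card_union_le _ _).trans ?_
    have h1 : (I.biUnion Y).card ≤ I.card * Δ := card_biUnion_le_card_mul _ _ Δ fun p hp => by
      rw [(hY p hp).2]
      exact (hImem p hp).2.trans (hu _ (hImem p hp).1)
    calc X₀.card + (I.biUnion Y).card ≤ I.card * (Δ + 1) := by rw [hX₀]; linarith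
      _ ≤ _ := Nat.mul_le_mul_right _ hIk
  have hXJ : ∀ z ∈ X, c z ∈ J := by
    intro z hz
    rcases mem_union.1 hz with h | h
    · obtain ⟨p, hp, rfl⟩ := mem_image.1 h
      rw [(hxZ p hp).1]
      exact (hImem p hp).1
    · obtain ⟨p, hp, hz⟩ := mem_biUnion.1 h
      exact ((hY p hp).1 z hz).2.2.1
  have hXH : ∀ p ∈ I, ∀ z ∈ X, (H (x p) z ↔ z ∈ Y p) := by
    refine fun p hp z hz => ⟨fun h => ?_, fun h => ((hY p hp).1 z h).2⟩
    rcases mem_union.1 hz with hz | hz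
    · obtain ⟨q, hq, rfl⟩ := mem_image.1 hz
      by_cases hpq : p = q
      · subst hpq; exact absurd h (hHirr _)
      · exact absurd (Or.inr (Or.inl h)) (hxR p hp q hq hpq)
    · obtain ⟨q, hq, hzq⟩ := mem_biUnion.1 hz
      by_cases hpq : p = q
      · subst hpq; exact hzq
      · exact absurd (Or.inr (Or.inr ⟨z, h, hHsymm _ _ ((hY q hq).1 z hzq).2⟩))
          (hxR p hp q hq hpq)
  have hYX : ∀ p ∈ I, Y p ⊆ X := fun p hp =>
    (subset_biUnion_of_mem Y hp).trans subset_union_right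
  have hxX : ∀ p ∈ I, x p ∈ X := fun p hp => mem_union_left _ (mem_image_of_mem x hp)
  have hadjX : ∀ p ∈ I, ∀ z ∈ X, z ≠ x p → (¬(G.Adj (x p) z ↔ s p.1 (c z)) ↔ z ∈ Y p) := by
    intro p hp z hz hne
    rw [← hXH p hp z hz, hH, Exceptional, (hxZ p hp).1]
    have := (hImem p hp).1
    have := hXJ z hz
    tauto
  have hYirr : ∀ p ∈ I, x p ∉ Y p := fun p hp h => hHirr _ ((hY p hp).1 _ h).2
  have hdegX : ∀ p ∈ I, (¬s p.1 p.1 ∧ (X.filter (G.Adj (x p))).card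
        = (X.filter fun z => s p.1 (c z)).card + p.2) ∨
      (s p.1 p.1 ∧ (X.filter (G.Adj (x p))).card + (p.2 + 1)
        = (X.filter fun z => s p.1 (c z)).card) := by
    intro p hp
    by_cases hsp : s p.1 p.1
    · refine Or.inr ⟨hsp, ?_⟩
      rw [← (hY p hp).2, ← card_insert_of_notMem (hYirr p hp), ← card_union_of_disjoint]
      · congr 1
        ext z
        simp only [mem_union, mem_filter, mem_insert]
        by_cases hzx : z = x p
        · simp [hzx, hxX p hp, (hxZ p hp).1, hsp]
        · by_cases hzX : z ∈ X
          · have h1 := hadjX p hp z hzX hzx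
            by_cases hzY : z ∈ Y p
            · have h2 := ((hY p hp).1 z hzY).1
              simp [hzX, hzY, h2, hsp]
            · simp only [hzX, hzY, hzx, true_and, or_false]
              tauto
          · have : z ∉ Y p := fun h => hzX (hYX p hp h)
            simp [hzX, hzx, this]
      · rw [disjoint_left]
        intro z hz hz'
        rw [mem_filter] at hz
        rcases mem_insert.1 hz' with rfl | hzY
        · exact G.loopless.irrefl _ hz.2
        · have h1 := hadjX p hp z hz.1 (fun h => hYirr p hp (h ▸ hzY))
          rw [((hY p hp).1 z hzY).1] at h1
          tauto
    · refine Or.inl ⟨hsp, ?_⟩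
      rw [← (hY p hp).2, ← card_union_of_disjoint]
      · congr 1
        ext z
        simp only [mem_union, mem_filter]
        by_cases hzx : z = x p
        · simp [hzx, hYirr p hp, (hxZ p hp).1, hsp]
        · by_cases hzX : z ∈ X
          · have h1 := hadjX p hp z hzX hzx
            by_cases hzY : z ∈ Y p
            · have h2 := ((hY p hp).1 z hzY).1
              rw [h2] at h1
              simp only [hzX, hzY, true_and, or_true, iff_true]
              tauto
            · simp only [hzX, hzY, true_and, or_false]
              tauto
          · have : z ∉ Y p := fun h => hzX (hYX p hp h)
            simp [hzX, this]
      · rw [disjoint_left]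
        intro z hz hzY
        rw [mem_filter, ((hY p hp).1 z hzY).1] at hz
        exact hsp hz.2
  rw [← hI, ← hX₀]
  refine card_le_fNumber_of_pools G (X := X) subset_union_left J
    (fun j => univ.filter fun z => c z = j ∧ z ∉ X ∧ ∀ v ∈ X₀, ¬H v z)
    (fun v => J.filter fun j => s (c v) j) (fun _ _ => filter_subset _ _) ?_ ?_ ?_ ?_ ?_
  · intro j hj
    have hsub : (univ.filter fun z => c z = j) ⊆
        (univ.filter fun z => c z = j ∧ z ∉ X ∧ ∀ v ∈ X₀, ¬H v z) ∪
          (X ∪ X₀.biUnion fun v => univ.filter (H v)) := by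
      intro z
      simp only [mem_filter, mem_univ, true_and, mem_union, mem_biUnion]
      intro hz
      by_cases h : ∃ v ∈ X₀, H v z
      · exact Or.inr (Or.inr h)
      · push Not at h
        by_cases hzX : z ∈ X
        · exact Or.inr (Or.inl hzX)
        · exact Or.inl ⟨hz, hzX, h⟩
    have h1 := (hlarge j hj).trans ((card_le_card hsub).trans (card_union_le _ _))
    have h2 := card_union_le X (X₀.biUnion fun v => univ.filter (H v))
    have h3 : (X₀.biUnion fun v => univ.filter (H v)).card ≤ X.card * Δ :=
      (card_biUnion_le_card_mul _ _ Δ fun v _ => hΔ v).trans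
        (Nat.mul_le_mul_right _ (card_le_card subset_union_left))
    have h4 : X.card * (Δ + 1) ≤ k * (Δ + 1) * (Δ + 1) * (Δ + 1) := Nat.mul_le_mul_right _ hXcard
    have h5 : X.card * 2 ^ J.card ≤ k * (Δ + 1) * (Δ + 1) * 2 ^ k :=
      Nat.mul_le_mul hXcard (Nat.pow_le_pow_right (by norm_num) hJ)
    refine h5.trans ?_
    rw [add_assoc, mul_add] at h1
    rw [mul_add] at h4
    linarith
  · intro i _ j _ hij
    rw [disjoint_left]
    intro z hz hz'
    simp only [mem_filter, mem_univ, true_and] at hz hz'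
    exact hij (hz.1.symm.trans hz'.1)
  · intro j _
    rw [disjoint_left]
    intro z hz
    simp only [mem_filter, mem_univ, true_and] at hz
    exact hz.2.1
  · intro v hv j hj z hz
    simp only [mem_filter, mem_univ, true_and] at hz
    have hvX : v ∈ X := mem_union_left _ hv
    have h1 : v ≠ z := fun h => hz.2.1 (h ▸ hvX)
    have h2 := hz.2.2 v hv
    rw [hH, Exceptional, hz.1] at h2
    have h3 := hXJ v hvX
    simp only [mem_filter, hj, true_and]
    tauto
  · intro v hv v' hv' hτ hcard
    obtain ⟨p, hp, rfl⟩ := mem_image.1 hv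
    obtain ⟨q, hq, rfl⟩ := mem_image.1 hv'
    have h1 : p.1 = q.1 := by
      refine hrow _ (hImem p hp).1 _ (hImem q hq).1 fun l hl => ?_
      have := Finset.ext_iff.1 hτ l
      simpa [hl, (hxZ p hp).1, (hxZ q hq).1] using this
    have h2 : p.2 = q.2 := by
      have hdp := hdegX p hp
      have hdq := hdegX q hq
      rw [h1] at hdp
      rcases hdp with ⟨h, hdp⟩ | ⟨h, hdp⟩ <;> rcases hdq with ⟨h', hdq⟩ | ⟨h', hdq⟩
      · omega
      · exact absurd h' h
      · exact absurd h h'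
      · omega
    exact congrArg x (Sigma.ext h1 (heq_of_eq h2))

/-- Bound on the number of exceptional neighbours of a vertex, for `k` clusters of radius `D`. -/
def exceptionBound (k D : ℕ) : ℕ := k * (3 * (2 * D))

/-- How many candidates suffice for choosing all special vertices greedily. -/
def candidateBound (k D : ℕ) : ℕ :=
  (1 + exceptionBound k D + exceptionBound k D * exceptionBound k D) *
    (k * (exceptionBound k D + 1)) + 1

/-- The size from which a cluster counts as large. -/
def clusterBound (k D : ℕ) : ℕ :=
  k * (exceptionBound k D + 1) * (exceptionBound k D + 1) * (2 ^ k + exceptionBound k D + 1) +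
    candidateBound k D + 2 * (3 * (2 * D)) + 1

/-- The separation that guarantees that large clusters of radius `D` have distinct patterns. -/
def separationBound (k D : ℕ) : ℕ :=
  k * clusterBound k D + exceptionBound k D + exceptionBound k D + 2 * D

theorem card_le_of_clusters [Nonempty V] {k D : ℕ} {S : Finset V} (hS : S.card ≤ k) (c : V → V)
    (hcS : ∀ v, c v ∈ S) (hcD : ∀ v, adjDist G v (c v) ≤ D)
    (hsep : ∀ x ∈ S, ∀ y ∈ S, x ≠ y → separationBound k D < adjDist G x y) :
    Fintype.card V ≤
      fNumber G * homNumber G + k * (clusterBound k D + candidateBound k D) := by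
  set L := clusterBound k D with hL
  set M := candidateBound k D with hM
  set Δ := exceptionBound k D with hΔ
  let C : V → Finset V := fun i => univ.filter fun x => c x = i
  let J := S.filter fun i => L ≤ (C i).card
  have hJk : J.card ≤ k := (card_filter_le _ _).trans hS
  have hJL : ∀ i ∈ J, L ≤ (C i).card := fun i hi => (mem_filter.1 hi).2
  have hdiam : ∀ i, ∀ x ∈ C i, ∀ y ∈ C i, adjDist G x y ≤ 2 * D := by
    intro i x hx y hy
    simp only [C, mem_filter, mem_univ, true_and] at hx hy
    have h1 := adjDist_triangle G x i y
    have h2 := hcD x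
    have h3 := hcD y
    rw [hx] at h2
    rw [hy, adjDist_comm] at h3
    omega
  have hpat : ∀ i j, ∃ s : Prop, i ∈ J →
      ∀ x ∈ C i, ((C j).filter fun y => ¬(G.Adj x y ↔ s)).card ≤ 3 * (2 * D) := by
    intro i j
    by_cases hi : i ∈ J
    · have h1 := hJL i hi
      rw [hL, clusterBound] at h1
      obtain ⟨s, hs⟩ := exists_almost_uniform G (hdiam i) (hdiam j) (by omega)
      exact ⟨s, fun _ => hs⟩
    · exact ⟨True, fun h => absurd h hi⟩
  choose s hs using hpat
  have hsymm : ∀ i ∈ J, ∀ j ∈ J, (s i j ↔ s j i) := by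
    intro i hi j hj
    have h1 := hJL i hi
    have h2 := hJL j hj
    rw [hL, clusterBound] at h1 h2
    exact almost_uniform_symm G (hs i j hi) (hs j i hj) (by omega) (by omega)
  have hexc : ∀ x, c x ∈ J →
      (J.biUnion fun j => (C j).filter fun y => ¬(G.Adj x y ↔ s (c x) j)).card ≤ Δ := by
    intro x hx
    refine (card_biUnion_le_card_mul _ _ (3 * (2 * D)) fun j _ =>
      hs (c x) j hx x (by simp [C])).trans ?_
    exact Nat.mul_le_mul_right _ hJk
  have hdeg : ∀ x, (univ.filter (Exceptional G c J s x)).card ≤ Δ := by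
    intro x
    by_cases hx : c x ∈ J
    · refine (card_le_card ?_).trans (hexc x hx)
      intro y hy
      obtain ⟨-, h2, -, h4⟩ := (mem_filter.1 hy).2
      exact mem_biUnion.2 ⟨c y, h2, by simp [C, h4]⟩
    · rw [filter_false_of_mem fun y _ h => hx h.1]
      simp
  have hsmall : ((S \ J).biUnion C).card ≤ k * L := by
    refine (card_biUnion_le_card_mul _ _ L fun i hi => ?_).trans
      (Nat.mul_le_mul_right _ ((card_le_card sdiff_subset).trans hS))
    rw [mem_sdiff] at hi
    by_contra h
    exact hi.2 (mem_filter.2 ⟨hi.1, (not_le.1 h).le⟩)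
  have hrow : ∀ i ∈ J, ∀ j ∈ J, (∀ l ∈ J, s i l ↔ s j l) → i = j := by
    intro i hi j hj h
    by_contra hne
    have hpos : 0 < L := by rw [hL, clusterBound]; omega
    obtain ⟨x, hx⟩ := card_pos.1 (hpos.trans_le (hJL i hi))
    obtain ⟨y, hy⟩ := card_pos.1 (hpos.trans_le (hJL j hj))
    simp only [C, mem_filter, mem_univ, true_and] at hx hy
    subst hx hy
    have hsub : (univ.filter fun z => ¬(G.Adj x z ↔ G.Adj y z)) ⊆
        (S \ J).biUnion C ∪
          (J.biUnion fun j => (C j).filter fun z => ¬(G.Adj x z ↔ s (c x) j)) ∪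
          J.biUnion fun j => (C j).filter fun z => ¬(G.Adj y z ↔ s (c y) j) := by
      intro z hz
      simp only [mem_filter, mem_univ, true_and] at hz
      simp only [C, mem_union, mem_biUnion, mem_sdiff, mem_filter, mem_univ, true_and]
      by_cases hzJ : c z ∈ J
      · have h1 := h _ hzJ
        by_cases h2 : G.Adj x z ↔ s (c x) (c z)
        · exact Or.inr ⟨c z, hzJ, rfl, by tauto⟩
        · exact Or.inl (Or.inr ⟨c z, hzJ, rfl, h2⟩)
      · exact Or.inl (Or.inl ⟨c z, ⟨hcS z, hzJ⟩, rfl⟩)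
    have h1 : adjDist G x y ≤ k * L + Δ + Δ :=
      (card_le_card hsub).trans ((card_union_le _ _).trans (add_le_add
        ((card_union_le _ _).trans (add_le_add hsmall (hexc x hi))) (hexc y hj)))
    have h2 := hsep _ (hcS x) _ (hcS y) hne
    have h3 := adjDist_triangle G (c x) x (c y)
    have h4 := adjDist_triangle G x y (c y)
    have h5 := hcD x
    have h6 := hcD y
    rw [adjDist_comm] at h5
    rw [separationBound, ← hL, ← hΔ] at h2
    omega
  let f : V → ℕ := fun x =>
    (univ.filter fun y => c y = c x ∧ Exceptional G c J s x y).card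
  have hf : ∀ x, f x ≤ Δ := fun x =>
    (card_le_card (monotone_filter_right _ fun _ _ h => h.2)).trans (hdeg x)
  have hu : ∀ i, ∃ u, i ∈ J → u ≤ Δ ∧ M ≤ ((C i).filter fun x => u ≤ f x).card ∧
      ((C i).filter fun x => ¬f x ≤ u).card < M := by
    intro i
    by_cases hi : i ∈ J
    · have h1 := hJL i hi
      rw [hL, clusterBound] at h1
      obtain ⟨u, h⟩ := exists_last_frequent_value (C := C i) f (M := M)
        (by rw [hM, candidateBound]; omega) (by omega) fun x _ => hf x
      exact ⟨u, fun _ => h⟩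
    · exact ⟨0, fun h => absurd h hi⟩
  choose u hu using hu
  have hsum : ∑ i ∈ J, (u i + 1) ≤ fNumber G := by
    refine sum_le_fNumber_of_exceptional G c J s k Δ hJk hsymm hrow hdeg u
      (fun i hi => (hu i hi).1) (fun i hi => ?_) (fun i hi => ?_)
    · have h1 := (hu i hi).2.1
      rw [hM, candidateBound] at h1
      refine (Nat.lt_of_succ_le h1).trans_le (card_le_card ?_)
      intro x hx
      simp only [C, f, mem_filter, mem_univ, true_and] at hx ⊢
      refine ⟨hx.1, ?_⟩
      rw [← hx.1]
      exact hx.1.symm ▸ hx.2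
    · refine le_trans ?_ (hJL i hi)
      rw [hL, clusterBound, ← hΔ]
      omega
  have hC : ∀ i ∈ J, (C i).card ≤ (u i + 1) * homNumber G + M := by
    intro i hi
    obtain ⟨I, hI, hind, hcard⟩ := exists_independent_of_degree_le (Exceptional G c J s)
      (by
        rintro v w ⟨h1, h2, h3, h4⟩
        exact ⟨h2, h1, h3.symm, by rwa [G.adj_comm, hsymm _ h2 _ h1]⟩)
      (fun v h => h.2.2.1 rfl) (u i) ((C i).filter fun x => f x ≤ u i)
      (by
        intro x hx
        simp only [C, mem_filter, mem_univ, true_and] at hx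
        refine le_trans (card_le_card ?_) hx.2
        intro y hy
        simp only [C, mem_filter, mem_univ, true_and] at hy ⊢
        exact ⟨hy.1.1.trans hx.1.symm, hy.2⟩)
    have hIc : ∀ x ∈ I, c x = i := fun x hx => (mem_filter.1 (mem_filter.1 (hI hx)).1).2
    have hadj : ∀ x ∈ I, ∀ y ∈ I, x ≠ y → (G.Adj x y ↔ s i i) := by
      intro x hx y hy hne
      have := hind x hx y hy
      rw [Exceptional, hIc x hx, hIc y hy] at this
      tauto
    have hhom : I.card ≤ homNumber G := by
      apply card_le_homNumber
      by_cases hsi : s i i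
      · exact Or.inl fun x hx y hy hne => (hadj x hx y hy hne).2 hsi
      · refine Or.inr fun x hx y hy hne => ?_
        rw [SimpleGraph.compl_adj]
        exact ⟨hne, fun h => hsi ((hadj x hx y hy hne).1 h)⟩
    have h1 : ((C i).filter fun x => f x ≤ u i).card + ((C i).filter fun x => ¬f x ≤ u i).card
        = (C i).card := card_filter_add_card_filter_not _
    have h2 := (hu i hi).2.2
    have h3 := Nat.mul_le_mul_left (u i + 1) hhom
    omega
  have huniv : (univ : Finset V) ⊆ (S \ J).biUnion C ∪ J.biUnion C := by
    intro x _
    rw [mem_union, mem_biUnion, mem_biUnion]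
    by_cases hx : c x ∈ J
    · exact Or.inr ⟨c x, hx, by simp [C]⟩
    · exact Or.inl ⟨c x, mem_sdiff.2 ⟨hcS x, hx⟩, by simp [C]⟩
  have h1 : (J.biUnion C).card ≤ fNumber G * homNumber G + k * M := by
    refine card_biUnion_le.trans ((sum_le_sum hC).trans ?_)
    rw [sum_add_distrib, ← sum_mul, sum_const, smul_eq_mul]
    exact add_le_add (Nat.mul_le_mul_right _ hsum) (Nat.mul_le_mul_right _ hJk)
  have h2 := (card_le_card huniv).trans (card_union_le _ _)
  rw [card_univ] at h2
  rw [mul_add]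
  omega

end Clusters

/-- An `n`-vertex graph with fewer than `k` distinct degrees in every induced subgraph has a
homogeneous set of size at least `n / f(G)`, up to an additive constant. -/
theorem exists_card_le_fNumber_mul_homNumber_add (k : ℕ) :
    ∃ B : ℕ, ∀ (V : Type) [Fintype V] (G : SimpleGraph V),
      k ≤ fNumber G ∨ Fintype.card V ≤ fNumber G * homNumber G + B := by
  let F : ℕ → ℕ := fun D => separationBound k D + (k + 2 ^ k * (k * 2 ^ 2 ^ k))
  have hF : ∀ D, D ≤ F D := fun D => by simp only [F, separationBound]; omega
  let b : ℕ → ℕ := fun m =>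
    k * (clusterBound k (F^[m] 0) + candidateBound k (F^[m] 0))
  refine ⟨∑ m ∈ range (k + 1), b m, fun V _ G => ?_⟩
  by_cases hV : Nonempty V
  swap
  · right
    rw [not_nonempty_iff] at hV
    simp
  obtain ⟨m, hm, S, hS, hsep, h⟩ := exists_separated_dense (adjDist G) (adjDist_self G)
    (adjDist_comm G) F hF k ∅ (by simp)
  rw [card_empty, zero_add] at hS h
  rcases h with h | h
  · left
    rw [← h]
    apply card_le_fNumber_of_separated
    intro x hx y hy hne
    rw [h]
    exact (Nat.le_add_left _ _).trans_lt (hsep x hx y hy hne)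
  · right
    choose c hcS hcD using h
    refine (card_le_of_clusters G hS c hcS hcD fun x hx y hy hne =>
      (Nat.le_add_right _ _).trans_lt (hsep x hx y hy hne)).trans (Nat.add_le_add_left ?_ _)
    exact single_le_sum (f := b) (fun _ _ => Nat.zero_le _) (mem_range.2 (by omega))

/-- For fixed `k ≥ 1` and `ε > 0`, every sufficiently large `n`-vertex graph `G` with
`hom(G) < n/(k-1+ε)` satisfies `f(G) ≥ k`. -/
theorem stmt_1 (k : ℕ) (hk : 0 < k) (ε : ℝ) (hε : 0 < ε) :
    ∃ N : ℕ, ∀ n : ℕ, N ≤ n → ∀ G : SimpleGraph (Fin n),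
      (homNumber G : ℝ) < (n : ℝ) / ((k : ℝ) - 1 + ε) → k ≤ fNumber G := by
  obtain ⟨B, hB⟩ := exists_card_le_fNumber_mul_homNumber_add k
  refine ⟨⌊B * ((k : ℝ) - 1 + ε) / ε⌋₊ + 1, fun n hn G hhom => ?_⟩
  by_contra hlt
  have hn' : B * ((k : ℝ) - 1 + ε) / ε < n :=
    (Nat.lt_floor_add_one _).trans_le (by exact_mod_cast hn)
  have hcard := (hB (Fin n) G).resolve_left hlt
  rw [Fintype.card_fin] at hcard
  have hk1 : (1 : ℝ) ≤ k := by exact_mod_cast hk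
  have hf : (fNumber G : ℝ) ≤ k - 1 := by
    have : fNumber G + 1 ≤ k := by omega
    have : (fNumber G : ℝ) + 1 ≤ k := by exact_mod_cast this
    linarith
  have hpos : 0 < (k : ℝ) - 1 + ε := by linarith
  have hreal : (n : ℝ) ≤ fNumber G * homNumber G + B := by exact_mod_cast hcard
  rw [lt_div_iff₀ hpos] at hhom
  rw [div_lt_iff₀ hε] at hn'
  have h1 : (fNumber G : ℝ) * homNumber G ≤ (k - 1) * homNumber G :=
    mul_le_mul_of_nonneg_right hf (Nat.cast_nonneg _)
  have h2 : (n : ℝ) * (k - 1 + ε) ≤ ((k - 1) * homNumber G + B) * (k - 1 + ε) :=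
    mul_le_mul_of_nonneg_right (by linarith) hpos.le
  have h3 : ((k : ℝ) - 1) * (homNumber G * (k - 1 + ε)) ≤ (k - 1) * n :=
    mul_le_mul_of_nonneg_left hhom.le (by linarith)
  linarith
end

section
/- Let K be a natural number and let G be a finite simple graph such that δ(x,y) ≤ K for all vertices x,y of G. Then either G has maximum degree at most 4K, or the complement of G has maximum degree at most 4K. -/
open Finset
open scoped Classical

/-- Complementary degrees differ by at most the neighbourhood-distance. -/
lemma degree_compl_le_add_nbhdDist {V : Type*} [Fintype V] (G : SimpleGraph V) (u v : V) :
    Gᶜ.degree u ≤ Gᶜ.degree v + nbhdDist G u v := by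
  have hsub : (Gᶜ.neighborFinset u).erase v ⊆ (Gᶜ.neighborFinset v).erase u ∪
      symmDiff ((G.neighborFinset u).erase v) ((G.neighborFinset v).erase u) := by
    intro w
    simp only [mem_union, mem_symmDiff, mem_erase, SimpleGraph.mem_neighborFinset,
      SimpleGraph.compl_adj]
    grind
  have hle := (card_le_card hsub).trans (card_union_le _ _)
  have hu : #(Gᶜ.neighborFinset u) = Gᶜ.degree u := rfl
  have hv : #(Gᶜ.neighborFinset v) = Gᶜ.degree v := rfl
  have hd : #(symmDiff ((G.neighborFinset u).erase v) ((G.neighborFinset v).erase u)) =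
      nbhdDist G u v := rfl
  by_cases huv : Gᶜ.Adj u v
  · have hmu : v ∈ Gᶜ.neighborFinset u := by simpa only [SimpleGraph.mem_neighborFinset]
    have hmv : u ∈ Gᶜ.neighborFinset v := by
      simpa only [SimpleGraph.mem_neighborFinset] using huv.symm
    have := card_erase_add_one hmu
    have := card_erase_add_one hmv
    omega
  · have hmu : v ∉ Gᶜ.neighborFinset u := by simpa only [SimpleGraph.mem_neighborFinset]
    have hmv : u ∉ Gᶜ.neighborFinset v := by
      simpa only [SimpleGraph.mem_neighborFinset] using fun h => huv h.symm
    rw [erase_eq_of_notMem hmu, erase_eq_of_notMem hmv] at hle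
    omega

/-- Double counting the edges between the neighbours and the non-neighbours of `v`. -/
lemma degree_compl_mul_le {V : Type*} [Fintype V] {K : ℕ} {G : SimpleGraph V} {v : V}
    (h : ∀ x : V, nbhdDist G v x ≤ K) :
    Gᶜ.degree v * (G.degree v - K) ≤ G.degree v * K := by
  refine card_mul_le_card_mul (s := Gᶜ.neighborFinset v) (t := G.neighborFinset v) G.Adj ?_ ?_
  · intro b hb
    rw [SimpleGraph.mem_neighborFinset, SimpleGraph.compl_adj] at hb
    have hsub : G.neighborFinset v ⊆ (G.neighborFinset v).bipartiteAbove G.Adj b ∪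
        symmDiff ((G.neighborFinset v).erase b) ((G.neighborFinset b).erase v) := by
      intro w
      simp only [mem_union, mem_symmDiff, mem_erase, SimpleGraph.mem_neighborFinset,
        mem_bipartiteAbove]
      grind
    have hle := (card_le_card hsub).trans (card_union_le _ _)
    rw [Nat.sub_le_iff_le_add]
    exact hle.trans (Nat.add_le_add_left (h b) _)
  · intro a ha
    rw [SimpleGraph.mem_neighborFinset] at ha
    refine (card_le_card ?_).trans (h a)
    intro w
    simp only [mem_symmDiff, mem_erase, SimpleGraph.mem_neighborFinset,
      mem_bipartiteBelow, SimpleGraph.compl_adj]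
    grind [SimpleGraph.adj_comm]

/-- If all neighbourhood-distances in `G` are at most `K`, then `G` or its complement has
maximum degree at most `4K`. -/
theorem stmt_2 {V : Type*} [Fintype V] (K : ℕ) (G : SimpleGraph V)
    (h : ∀ x y : V, nbhdDist G x y ≤ K) :
    (∀ v : V, G.degree v ≤ 4 * K) ∨ (∀ v : V, Gᶜ.degree v ≤ 4 * K) := by
  by_contra! hcon
  obtain ⟨⟨v, hv⟩, u, hu⟩ := hcon
  have hcount := degree_compl_mul_le (h v)
  have hdiff := (degree_compl_le_add_nbhdDist G u v).trans (Nat.add_le_add_left (h u v) _)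
  obtain ⟨d, hd⟩ := Nat.exists_eq_add_of_lt hv
  have hsub : G.degree v - K = 3 * K + d + 1 := by omega
  rw [hsub] at hcount
  have hb : 3 * K + 1 ≤ Gᶜ.degree v := by omega
  have := Nat.mul_le_mul_right (3 * K + d + 1) hb
  nlinarith [Nat.zero_le (K * d), Nat.zero_le (K * K)]
end

section
/- Every finite simple graph G contains an independent set of size at least Σ_{v ∈ V(G)} 1/(deg(v)+1), and moreover Σ_{v ∈ V(G)} 1/(deg(v)+1) ≥ v(G)²/(2·e(G)+v(G)), where v(G) and e(G) denote the number of vertices and edges of G respectively. -/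
open Finset
open scoped Classical

/-- The greedy bound: repeatedly picking a vertex of minimum degree and deleting its closed
neighbourhood yields a large independent subset of `t`. -/
theorem SimpleGraph.exists_independent_subset_sum_le_card {V : Type*} (G : SimpleGraph V)
    (t : Finset V) :
    ∃ s ⊆ t, (∀ x ∈ s, ∀ y ∈ s, ¬ G.Adj x y) ∧
      ∑ v ∈ t, (1 : ℝ) / ((#{w ∈ t | G.Adj v w} : ℝ) + 1) ≤ #s := by
  induction t using Finset.strongInduction with
  | H t ih =>
    rcases t.eq_empty_or_nonempty with rfl | ht
    · exact ⟨∅, by simp⟩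
    obtain ⟨v, hv, hmin⟩ := exists_min_image t (fun x => #{w ∈ t | G.Adj x w}) ht
    set N := insert v {w ∈ t | G.Adj v w} with hN
    have hNt : N ⊆ t := insert_subset hv (filter_subset _ _)
    have hcard : #N = #{w ∈ t | G.Adj v w} + 1 := card_insert_of_notMem (by simp)
    obtain ⟨s, hst, hs, hsum⟩ := ih (t \ N)
      (sdiff_ssubset hNt ⟨v, mem_insert_self _ _⟩)
    have hnot : ∀ x ∈ s, ¬ G.Adj v x := fun x hx hvx => by
      have := mem_sdiff.1 (hst hx)
      exact this.2 (mem_insert_of_mem (mem_filter.2 ⟨this.1, hvx⟩))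
    have hvs : v ∉ s := fun h => (mem_sdiff.1 (hst h)).2 (mem_insert_self _ _)
    refine ⟨insert v s, insert_subset hv (hst.trans sdiff_subset), ?_, ?_⟩
    · intro x hx y hy
      rcases mem_insert.1 hx with rfl | hxs <;> rcases mem_insert.1 hy with rfl | hys
      · exact G.irrefl
      · exact hnot y hys
      · exact fun h => hnot x hxs h.symm
      · exact hs x hxs y hys
    · rw [card_insert_of_notMem hvs, ← sum_sdiff hNt, Nat.cast_add, Nat.cast_one]
      refine add_le_add (le_trans (sum_le_sum fun x _ => ?_) hsum) ?_
      · gcongr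
        exact sdiff_subset
      · calc ∑ x ∈ N, (1 : ℝ) / ((#{w ∈ t | G.Adj x w} : ℝ) + 1)
            ≤ ∑ _x ∈ N, (1 : ℝ) / #N := by
              refine sum_le_sum fun x hx => ?_
              rw [hcard, Nat.cast_add, Nat.cast_one]
              gcongr 1 / (?_ + 1)
              exact_mod_cast hmin x (hNt hx)
          _ = 1 := by
              rw [sum_const, nsmul_eq_mul, mul_one_div_cancel]
              rw [hcard]
              positivity

/-- Caro–Wei: `G` contains an independent set of size at least `Σ_v 1/(deg(v)+1)`, and this
sum is at least `v(G)²/(2e(G)+v(G))`. -/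
theorem stmt_4 {V : Type*} [Fintype V] (G : SimpleGraph V) :
    (∃ s : Finset V, (∀ x ∈ s, ∀ y ∈ s, ¬ G.Adj x y) ∧
        (s.card : ℝ) ≥ ∑ v : V, (1 : ℝ) / ((G.degree v : ℝ) + 1)) ∧
      (∑ v : V, (1 : ℝ) / ((G.degree v : ℝ) + 1)) ≥
        ((Fintype.card V : ℝ)) ^ 2 / (2 * (G.edgeSet.ncard : ℝ) + (Fintype.card V : ℝ)) := by
  refine ⟨?_, ?_⟩
  · obtain ⟨s, -, hs, hsum⟩ := G.exists_independent_subset_sum_le_card univ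
    refine ⟨s, hs, ?_⟩
    simpa only [← G.card_neighborFinset_eq_degree, G.neighborFinset_eq_filter] using hsum
  · have hedges : 2 * (G.edgeSet.ncard : ℝ) + Fintype.card V
        = ∑ v : V, ((G.degree v : ℝ) + 1) := by
      rw [Set.ncard_eq_toFinset_card', sum_add_distrib, ← Nat.cast_sum,
        G.sum_degrees_eq_twice_card_edges]
      simp [SimpleGraph.edgeFinset]
    rw [hedges]
    simpa using sq_sum_div_le_sum_sq_div univ (fun _ : V => (1 : ℝ))
      (g := fun v => (G.degree v : ℝ) + 1) fun v _ => by positivity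
end

section
/- For any three vertices x, y, z of a finite simple graph G, the neighbourhood-distance satisfies the triangle inequality δ(x,y) + δ(y,z) ≥ δ(x,z). -/
open Finset
open scoped Classical

theorem mem_symmDiff_neighborFinset_erase {V : Type*} [Fintype V] (G : SimpleGraph V)
    (x y v : V) :
    v ∈ symmDiff ((G.neighborFinset x).erase y) ((G.neighborFinset y).erase x) ↔
      v ≠ x ∧ v ≠ y ∧ ¬(G.Adj x v ↔ G.Adj y v) := by
  have hx : G.Adj x v → v ≠ x := fun h => h.ne'
  have hy : G.Adj y v → v ≠ y := fun h => h.ne'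
  simp only [mem_symmDiff, mem_erase, SimpleGraph.mem_neighborFinset]
  tauto

/-- The neighbourhood-distance satisfies the triangle inequality. -/
theorem stmt_5 {V : Type*} [Fintype V] (G : SimpleGraph V) (x y z : V) :
    nbhdDist G x z ≤ nbhdDist G x y + nbhdDist G y z := by
  unfold nbhdDist
  have hxz := mem_symmDiff_neighborFinset_erase G x z
  have hxy := mem_symmDiff_neighborFinset_erase G x y
  have hyz := mem_symmDiff_neighborFinset_erase G y z
  generalize symmDiff ((G.neighborFinset x).erase z) ((G.neighborFinset z).erase x) = D at *
  generalize symmDiff ((G.neighborFinset x).erase y) ((G.neighborFinset y).erase x) = A at *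
  generalize symmDiff ((G.neighborFinset y).erase z) ((G.neighborFinset z).erase y) = B at *
  refine le_trans ?_ (card_union_le A B)
  have hsub : D.erase y ⊆ A ∪ B := by
    intro v hv
    simp only [mem_erase, mem_union, hxz, hxy, hyz] at hv ⊢
    tauto
  by_cases hy : y ∈ D
  · -- Exactly one of `x`, `z` is adjacent to `y`, so `x` or `z` can take the place of `y`.
    obtain ⟨w, hwD, hw⟩ : ∃ w, w ∉ D ∧ w ∈ A ∪ B := by
      obtain ⟨hyx, hyz', hadj⟩ := (hxz y).1 hy
      have hne : x ≠ z := by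
        rintro rfl
        exact hadj Iff.rfl
      by_cases h : G.Adj x z ↔ G.Adj y z
      · refine ⟨x, by simp [hxz], mem_union_right _ ((hyz x).2 ⟨hyx.symm, hne, ?_⟩)⟩
        rw [G.adj_comm y x, G.adj_comm z x, h, G.adj_comm y z]
        exact hadj
      · exact ⟨z, by simp [hxz], mem_union_left _ ((hxy z).2 ⟨hne.symm, hyz'.symm, h⟩)⟩
    calc D.card = (insert w (D.erase y)).card := by
          rw [card_insert_of_notMem fun h => hwD (mem_of_mem_erase h), card_erase_add_one hy]
      _ ≤ (A ∪ B).card := card_le_card (insert_subset hw hsub)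
  · rw [erase_eq_of_notMem hy] at hsub
    exact card_le_card hsub
end

section
/- Let G be a finite simple graph on vertex set V with |V| = n, and let x, y be distinct vertices of G. Then the number of subsets U ⊆ V satisfying |Γ(x) ∩ U| = |Γ(y) ∩ U| is strictly less than (20/√(δ(x,y)+1))·2ⁿ. Equivalently, if U is a uniformly random subset of V (each vertex included independently with probability 1/2), then the probability that x and y have the same degree in the induced subgraph G[U] is strictly less than 20/√(δ(x,y)+1). -/
open Finset
open scoped Classical

theorem Nat.centralBinom_sq_mul_le (n : ℕ) : n.centralBinom ^ 2 * (2 * n + 1) ≤ 16 ^ n := by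
  induction n with
  | zero => simp
  | succ n ih =>
    refine Nat.le_of_mul_le_mul_left ?_ (show 0 < (n + 1) ^ 2 by positivity)
    calc (n + 1) ^ 2 * ((n + 1).centralBinom ^ 2 * (2 * (n + 1) + 1))
        = ((n + 1) * (n + 1).centralBinom) ^ 2 * (2 * n + 3) := by ring
      _ = (4 * (2 * n + 1) * (2 * n + 3)) * (n.centralBinom ^ 2 * (2 * n + 1)) := by
        rw [Nat.succ_mul_centralBinom_succ]; ring
      _ ≤ (16 * (n + 1) ^ 2) * 16 ^ n := Nat.mul_le_mul (by nlinarith) ih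
      _ = (n + 1) ^ 2 * 16 ^ (n + 1) := by ring

theorem Nat.choose_sq_mul_succ_le (d k : ℕ) : d.choose k ^ 2 * (d + 1) ≤ 2 * 4 ^ d := by
  obtain ⟨m, rfl | rfl⟩ := d.even_or_odd'
  · calc (2 * m).choose k ^ 2 * (2 * m + 1)
        ≤ m.centralBinom ^ 2 * (2 * m + 1) := by gcongr; exact Nat.choose_le_centralBinom k m
      _ ≤ 16 ^ m := Nat.centralBinom_sq_mul_le m
      _ ≤ 2 * 4 ^ (2 * m) := by rw [pow_mul]; norm_num
  · have h : (2 * m + 1).choose k ≤ 2 * m.centralBinom := by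
      cases k with
      | zero =>
        have := Nat.centralBinom_pos m
        rw [Nat.choose_zero_right]
        omega
      | succ k =>
        rw [Nat.choose_succ_succ']
        have := Nat.choose_le_centralBinom k m
        have := Nat.choose_le_centralBinom (k + 1) m
        omega
    calc (2 * m + 1).choose k ^ 2 * (2 * m + 1 + 1)
        ≤ (2 * m.centralBinom) ^ 2 * (2 * (2 * m + 1)) := by gcongr; omega
      _ = 8 * (m.centralBinom ^ 2 * (2 * m + 1)) := by ring
      _ ≤ 8 * 16 ^ m := by gcongr; exact Nat.centralBinom_sq_mul_le m
      _ = 2 * 4 ^ (2 * m + 1) := by rw [pow_succ, pow_mul]; norm_num; ring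

theorem Finset.card_filter_card_inter_eq_le {V : Type*} [Fintype V] (A B : Finset V) :
    (Finset.univ.filter fun U : Finset V => (A ∩ U).card = (B ∩ U).card).card ≤
      (symmDiff A B).card.choose (B \ A).card * 2 ^ (Fintype.card V - (symmDiff A B).card) := by
  rw [← Finset.card_compl, ← Finset.card_powerset, ← Finset.card_powersetCard,
    ← Finset.card_product]
  refine Finset.card_le_card_of_injOn
    (fun U => ((A \ B) ∩ U ∪ (B \ A) \ U, U \ symmDiff A B)) ?_ ?_
  · intro U hU
    simp only [Finset.coe_filter, Finset.mem_univ, true_and, Set.mem_ofPred_eq] at hU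
    simp only [Finset.coe_product, Set.mem_prod, Finset.mem_coe, Finset.mem_powersetCard,
      Finset.mem_powerset]
    refine ⟨⟨fun v => ?_, ?_⟩, fun v => ?_⟩
    · simp only [Finset.mem_union, Finset.mem_inter, Finset.mem_sdiff, Finset.mem_symmDiff]
      tauto
    · have hA : ((A \ B) ∩ U).card + (A ∩ B ∩ U).card = (A ∩ U).card := by
        rw [← Finset.card_union_of_disjoint]
        · congr 1; grind
        · rw [Finset.disjoint_left]; grind
      have hB : ((B \ A) ∩ U).card + (A ∩ B ∩ U).card = (B ∩ U).card := by
        rw [← Finset.card_union_of_disjoint]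
        · congr 1; grind
        · rw [Finset.disjoint_left]; grind
      have hQ := Finset.card_inter_add_card_sdiff (B \ A) U
      rw [Finset.card_union_of_disjoint]
      · omega
      · rw [Finset.disjoint_left]; grind
    · simp only [Finset.mem_sdiff, Finset.mem_compl]
      tauto
  · intro U _ W _ h
    simp only [Prod.mk.injEq, Finset.ext_iff, Finset.mem_union, Finset.mem_inter,
      Finset.mem_sdiff, Finset.mem_symmDiff] at h
    ext v
    have h1 := h.1 v
    have h2 := h.2 v
    by_cases hA : v ∈ A <;> by_cases hB : v ∈ B <;> simp_all [not_iff_not]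

theorem nbhdDist_le_card_symmDiff {V : Type*} [Fintype V] (G : SimpleGraph V) (x y : V) :
    nbhdDist G x y ≤ (symmDiff (G.neighborFinset x) (G.neighborFinset y)).card := by
  refine Finset.card_le_card fun v => ?_
  simp only [Finset.mem_symmDiff, Finset.mem_erase, SimpleGraph.mem_neighborFinset]
  have hx : ¬ G.Adj x x := G.irrefl
  have hy : ¬ G.Adj y y := G.irrefl
  grind

/-- For distinct vertices `x, y` of an `n`-vertex graph `G`, the number of subsets `U` of the
vertices with `|Γ(x) ∩ U| = |Γ(y) ∩ U|` is less than `(20/√(δ(x,y)+1))·2ⁿ`; equivalently, a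
uniformly random subset `U` satisfies `deg_{G[U]}(x) = deg_{G[U]}(y)` with probability less
than `20/√(δ(x,y)+1)`. -/
theorem stmt_6 {V : Type*} [Fintype V] (G : SimpleGraph V) (x y : V) (hxy : x ≠ y) :
    ((Finset.univ.filter fun U : Finset V =>
        (G.neighborFinset x ∩ U).card = (G.neighborFinset y ∩ U).card).card : ℝ) <
      20 / Real.sqrt ((nbhdDist G x y : ℝ) + 1) * 2 ^ (Fintype.card V) := by
  have hcount := Finset.card_filter_card_inter_eq_le (G.neighborFinset x) (G.neighborFinset y)
  have hdist := nbhdDist_le_card_symmDiff G x y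
  set d := (symmDiff (G.neighborFinset x) (G.neighborFinset y)).card
  set k := (G.neighborFinset y \ G.neighborFinset x).card
  set δ := nbhdDist G x y
  have hd : d ≤ Fintype.card V := Finset.card_le_univ _
  have hchoose : ((d.choose k : ℝ)) ^ 2 * (d + 1) ≤ 2 * 4 ^ d := by
    exact_mod_cast Nat.choose_sq_mul_succ_le d k
  have hδ : (δ : ℝ) + 1 ≤ d + 1 := by exact_mod_cast Nat.succ_le_succ hdist
  have hlt : (d.choose k : ℝ) * √((δ : ℝ) + 1) < 20 * 2 ^ d := by
    refine lt_of_pow_lt_pow_left₀ 2 (by positivity) ?_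
    rw [mul_pow, mul_pow, Real.sq_sqrt (by positivity), ← pow_mul, mul_comm d, pow_mul]
    norm_num
    have h4 : (0 : ℝ) < 4 ^ d := by positivity
    have := mul_le_mul_of_nonneg_left hδ (sq_nonneg (d.choose k : ℝ))
    linarith
  calc _ ≤ (d.choose k : ℝ) * 2 ^ (Fintype.card V - d) := by exact_mod_cast hcount
    _ < 20 * 2 ^ d / √((δ : ℝ) + 1) * 2 ^ (Fintype.card V - d) := by
      gcongr
      rwa [lt_div_iff₀ (by positivity)]
    _ = 20 / √((δ : ℝ) + 1) * 2 ^ Fintype.card V := by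
      rw [← Nat.add_sub_cancel' hd, pow_add, Nat.add_sub_cancel_left]
      ring
end

section
/- Let b, c, m be positive integers with b·c ≤ m, let H be the disjoint union of m cliques each of size b, and let G be the disjoint union of c copies of the complement of H (so G has c·m·b vertices). Then hom(G) = m and f(G) = b·c. -/
open Finset
open scoped Classical

/-- `G` is the disjoint union of `c` complete `m`-partite graphs with parts of size `b`. -/
def IsCompletePartUnion {b c m : ℕ} (G : SimpleGraph (Fin c × Fin m × Fin b)) : Prop :=
  ∀ x y : Fin c × Fin m × Fin b, G.Adj x y ↔ (x.1 = y.1 ∧ x.2.1 ≠ y.2.1)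

/-- The vertices of `s` lying in part `u` of copy `i`. -/
noncomputable def partOf {b c m : ℕ} (s : Finset (Fin c × Fin m × Fin b)) (i : Fin c) (u : Fin m) :
    Finset (Fin c × Fin m × Fin b) :=
  s.filter fun y => y.1 = i ∧ y.2.1 = u

/-- The vertices of `s` lying in copy `i`. -/
noncomputable def copyOf {b c m : ℕ} (s : Finset (Fin c × Fin m × Fin b)) (i : Fin c) :
    Finset (Fin c × Fin m × Fin b) :=
  s.filter fun y => y.1 = i

section

variable {b c m : ℕ} {G : SimpleGraph (Fin c × Fin m × Fin b)}

lemma card_partOf_le (s : Finset (Fin c × Fin m × Fin b)) (i : Fin c) (u : Fin m) :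
    (partOf s i u).card ≤ b := by
  have h : (partOf s i u).card ≤ (univ : Finset (Fin b)).card := by
    refine card_le_card_of_injOn (fun y => y.2.2) (fun _ _ => mem_univ _) ?_
    rintro ⟨i₁, u₁, t₁⟩ h₁ ⟨i₂, u₂, t₂⟩ h₂ h
    simp_all [partOf]
  simpa using h

lemma card_copyOf (s : Finset (Fin c × Fin m × Fin b)) (i : Fin c) :
    (copyOf s i).card = ∑ u, (partOf s i u).card := by
  rw [card_eq_sum_card_fiberwise (f := fun y => y.2.1) (t := univ) (by simp)]
  simp only [copyOf, partOf, filter_filter]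

lemma IsCompletePartUnion.degree_add_card_partOf (hG : IsCompletePartUnion G)
    (s : Finset (Fin c × Fin m × Fin b)) (x : Fin c × Fin m × Fin b) :
    (s.filter fun y => G.Adj x y).card + (partOf s x.1 x.2.1).card = (copyOf s x.1).card := by
  rw [copyOf, ← card_filter_add_card_filter_not (s := s.filter fun y => y.1 = x.1)
    (fun y => x.2.1 ≠ y.2.1), filter_filter, filter_filter]
  congr 2
  · ext y
    simp only [mem_filter, hG x y, eq_comm]
  · ext y
    simp only [partOf, mem_filter, not_not, eq_comm]

lemma IsCompletePartUnion.distinctDegrees_le (hG : IsCompletePartUnion G)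
    (s : Finset (Fin c × Fin m × Fin b)) : distinctDegrees G s ≤ b * c := by
  have hsub : (s.image fun x => (s.filter fun y => G.Adj x y).card) ⊆
      ((univ : Finset (Fin c)) ×ˢ Icc 1 b).image fun p => (copyOf s p.1).card - p.2 := by
    intro d hd
    obtain ⟨x, hx, rfl⟩ := mem_image.1 hd
    have hne : (partOf s x.1 x.2.1).Nonempty := ⟨x, by simp [partOf, hx]⟩
    refine mem_image.2 ⟨(x.1, (partOf s x.1 x.2.1).card), ?_, ?_⟩
    · simpa using ⟨hne, card_partOf_le s x.1 x.2.1⟩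
    · have := hG.degree_add_card_partOf s x
      dsimp only
      omega
  refine (card_le_card hsub).trans (card_image_le.trans ?_)
  simp [mul_comm]

/-- In copy `i`, `staircase` takes `min b (u + 1)` vertices from each part `u < b + i`. -/
noncomputable def staircase (b c m : ℕ) : Finset (Fin c × Fin m × Fin b) :=
  univ.filter fun x => x.2.2.val ≤ x.2.1.val ∧ x.2.1.val < b + x.1.val

lemma card_partOf_staircase (i : Fin c) (u : Fin m) :
    (partOf (staircase b c m) i u).card = if u.val < b + i.val then min b (u.val + 1) else 0 := by
  split_ifs with h
  · rw [← card_range (min b (u.val + 1))]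
    refine card_bij (fun y _ => y.2.2.val) ?_ ?_ ?_
    · rintro ⟨j, v, t⟩ hy
      simp only [partOf, staircase, mem_filter, mem_univ, true_and] at hy
      obtain ⟨⟨h₁, h₂⟩, rfl, rfl⟩ := hy
      simp
      omega
    · rintro ⟨i₁, u₁, t₁⟩ h₁ ⟨i₂, u₂, t₂⟩ h₂ h
      simp_all [partOf, Fin.ext_iff]
    · intro t ht
      rw [mem_range, lt_min_iff] at ht
      exact ⟨(i, u, ⟨t, ht.1⟩), by simp [partOf, staircase]; omega, rfl⟩
  · rw [card_eq_zero, partOf, filter_eq_empty_iff]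
    rintro ⟨j, v, t⟩ hy ⟨rfl, rfl⟩
    simp [staircase] at hy h
    omega

lemma card_copyOf_staircase (i : Fin c) (hi : b + i.val ≤ m) :
    (copyOf (staircase b c m) i).card = ∑ v ∈ range b, (v + 1) + i.val * b := by
  simp only [card_copyOf, card_partOf_staircase]
  rw [Fin.sum_univ_eq_sum_range (fun v => if v < b + i.val then min b (v + 1) else 0) m,
    ← sum_filter]
  have : (range m).filter (fun v => v < b + i.val) = range (b + i.val) := by
    ext v; simp; omega
  rw [this, sum_range_add]
  congr 1
  · exact sum_congr rfl fun v hv => min_eq_right (mem_range.1 hv)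
  · rw [sum_congr rfl (g := fun _ => b) fun v _ => by omega]
    simp

lemma IsCompletePartUnion.le_distinctDegrees_staircase (hG : IsCompletePartUnion G) (hb : 0 < b)
    (hbcm : b * c ≤ m) : b * c ≤ distinctDegrees G (staircase b c m) := by
  set T := ∑ v ∈ range b, (v + 1) with hT
  have hbT : b ≤ T := by
    have h : ∑ v ∈ range b, 1 ≤ T := sum_le_sum fun v _ => by omega
    simpa using h
  have hsub : (range (b * c)).image (fun e => T - b + e) ⊆
      (staircase b c m).image fun x => ((staircase b c m).filter fun y => G.Adj x y).card := by
    intro d hd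
    obtain ⟨e, he, rfl⟩ := mem_image.1 hd
    obtain ⟨q, r, hr, rfl⟩ : ∃ q r, r < b ∧ e = q * b + r :=
      ⟨e / b, e % b, Nat.mod_lt e hb, (Nat.div_add_mod' e b).symm⟩
    rw [mem_range] at he
    have hq : q < c := by nlinarith
    have hbq : b + q ≤ m := by nlinarith
    have hu : b - 1 - r < m := by omega
    refine mem_image.2 ⟨(⟨q, hq⟩, ⟨b - 1 - r, hu⟩, ⟨0, hb⟩), ?_, ?_⟩
    · simp only [staircase, mem_filter, mem_univ, true_and]
      omega
    · have hdeg := hG.degree_add_card_partOf (staircase b c m)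
        (⟨q, hq⟩, ⟨b - 1 - r, hu⟩, ⟨0, hb⟩)
      rw [card_partOf_staircase, card_copyOf_staircase _ hbq, if_pos (by dsimp only; omega),
        ← hT] at hdeg
      dsimp only at hdeg
      omega
  have h := card_le_card hsub
  rwa [card_image_of_injective _ (add_right_injective _), card_range] at h

lemma IsCompletePartUnion.fNumber_eq (hG : IsCompletePartUnion G) (hb : 0 < b)
    (hbcm : b * c ≤ m) : fNumber G = b * c := by
  refine IsGreatest.csSup_eq ⟨⟨staircase b c m, ?_⟩, ?_⟩
  · exact (hG.distinctDegrees_le _).antisymm (hG.le_distinctDegrees_staircase hb hbcm)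
  · rintro _ ⟨s, rfl⟩
    exact hG.distinctDegrees_le s

lemma IsCompletePartUnion.card_le_of_isClique (hG : IsCompletePartUnion G)
    {s : Finset (Fin c × Fin m × Fin b)} (hs : G.IsClique ↑s) : s.card ≤ m := by
  have h : s.card ≤ (univ : Finset (Fin m)).card := by
    refine card_le_card_of_injOn (fun y => y.2.1) (fun _ _ => mem_univ _) ?_
    intro x hx y hy hxy
    by_contra hne
    exact ((hG x y).1 (hs hx hy hne)).2 hxy
  simpa using h

lemma IsCompletePartUnion.card_le_of_isClique_compl (hG : IsCompletePartUnion G)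
    {s : Finset (Fin c × Fin m × Fin b)} (hs : Gᶜ.IsClique ↑s) : s.card ≤ b * c := by
  have h : s.card ≤ (univ : Finset (Fin b × Fin c)).card := by
    refine card_le_card_of_injOn (fun y => (y.2.2, y.1)) (fun _ _ => mem_univ _) ?_
    intro x hx y hy hxy
    obtain ⟨h₁, h₂⟩ := Prod.ext_iff.1 hxy
    by_contra hne
    have hadj := ((SimpleGraph.compl_adj G x y).1 (hs hx hy hne)).2
    refine hadj ((hG x y).2 ⟨h₂, fun h => hne ?_⟩)
    exact Prod.ext h₂ (Prod.ext h h₁)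
  simpa using h

lemma IsCompletePartUnion.homNumber_eq (hG : IsCompletePartUnion G) (hb : 0 < b) (hc : 0 < c)
    (hbcm : b * c ≤ m) : homNumber G = m := by
  refine IsGreatest.csSup_eq
    ⟨⟨univ.image fun u => (⟨0, hc⟩, u, ⟨0, hb⟩), Or.inl ?_, ?_⟩, ?_⟩
  · intro x hx y hy hne
    simp only [coe_image, coe_univ, Set.image_univ, Set.mem_range] at hx hy
    obtain ⟨u, rfl⟩ := hx
    obtain ⟨v, rfl⟩ := hy
    exact (hG _ _).2 ⟨rfl, fun h => hne (by simpa using h)⟩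
  · rw [card_image_of_injective _ fun u v h => by simpa using h]
    simp
  · rintro _ ⟨s, hs | hs, rfl⟩
    · exact hG.card_le_of_isClique hs
    · exact (hG.card_le_of_isClique_compl hs).trans hbcm

end

/-- Let `H` be the disjoint union of `m` cliques each of size `b`, and let `G` be the disjoint
union of `c` copies of the complement of `H`, where `b·c ≤ m`.  Realised on the vertex set
`Fin c × Fin m × Fin b`, the graph `G` joins `(i,u,s)` and `(j,v,t)` iff `i = j` and `u ≠ v`
(the complement of `H` joins two vertices iff they lie in different cliques of `H`).
Then `hom(G) = m` and `f(G) = b·c`. -/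
theorem stmt_15 (b c m : ℕ) (hb : 0 < b) (hc : 0 < c) (hm : 0 < m) (hbcm : b * c ≤ m)
    (G : SimpleGraph (Fin c × Fin m × Fin b))
    (hG : ∀ x y : Fin c × Fin m × Fin b, G.Adj x y ↔ (x.1 = y.1 ∧ x.2.1 ≠ y.2.1)) :
    homNumber G = m ∧ fNumber G = b * c := by
  have h : IsCompletePartUnion G := hG
  exact ⟨h.homNumber_eq hb hc hbcm, h.fNumber_eq hb hbcm⟩
end
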